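/- For every δ ∈ [0,1), every PCTSP instance, and every feasible solution (x,y) of the PCTSP LP relaxation, there exists a tour whose value (tour cost plus penalties of unvisited vertices) is at most α · (Σ_{e∈E} c_e x_e + Σ_{v∈V} π_v (1 − y_v)), where α := max{ (5−2δ)/(3−δ), (3−δ)/(2−δ), 1/(1−δ) }. -/

import Mathlib

/-- The edge set of the complete graph on `V`: all 2-element subsets of `V`. -/
def completeEdges (V : Type*) [Fintype V] [DecidableEq V] : Finset (Finset V) :=
  Finset.univ.powersetCard 2

/-- The cut `δ(S)`: edges of the complete graph with exactly one endpoint in `S`. -/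
def cutEdges (V : Type*) [Fintype V] [DecidableEq V] (S : Finset V) : Finset (Finset V) :=
  (completeEdges V).filter (fun e => (e ∩ S).card = 1)

/-- Feasibility for the PCTSP LP relaxation. -/
def IsFeasibleLP {V : Type*} [Fintype V] [DecidableEq V]
    (r : V) (x : Finset V → ℝ) (y : V → ℝ) : Prop :=
  (∀ e ∈ completeEdges V, 0 ≤ x e) ∧ (∀ v : V, 0 ≤ y v) ∧ y r = 1 ∧
  (∀ v : V, v ≠ r → ∑ e ∈ cutEdges V {v}, x e = 2 * y v) ∧
  (∑ e ∈ cutEdges V {r}, x e ≤ 2) ∧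
  (∀ S : Finset V, r ∉ S → ∀ v ∈ S, 2 * y v ≤ ∑ e ∈ cutEdges V S, x e)

/-- The cost of a tour given as a list of (distinct) vertices: the sum of the costs of
consecutive edges, plus the closing edge back to the start if the tour has at least two
vertices. -/
def tourCost {V : Type*} [DecidableEq V] (c : Finset V → ℝ) (t : List V) : ℝ :=
  if t.length ≤ 1 then 0
  else ((t.zip (t.rotate 1)).map (fun p => c {p.1, p.2})).sum

set_option linter.unusedSectionVars false

namespace PCTSP

section Splitting

variable {V : Type*} [Fintype V] [DecidableEq V]

/-- The indicator of the edges (as unordered pairs) with exactly one end in `S`. -/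
noncomputable def cutInd (S : Finset V) (e : Sym2 V) : ℝ :=
  open Classical in if (∃ a ∈ e, a ∈ S) ∧ (∃ b ∈ e, b ∉ S) then 1 else 0

/-- The total weight of the cut of `S`. -/
noncomputable def cutVal (z : Sym2 V → ℝ) (S : Finset V) : ℝ := ∑ e, z e * cutInd S e

/-- Splitting off: replace an amount `ε` of the edges `uv` and `vw` by the edge `uw`. -/
def splitOff (z : Sym2 V → ℝ) (u v w : V) (ε : ℝ) : Sym2 V → ℝ := fun e =>
  z e - ε * (if e = s(u, v) then 1 else 0) - ε * (if e = s(v, w) then 1 else 0)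
    + ε * (if e = s(u, w) then 1 else 0)

/-- Proper cut requirement functions. -/
structure IsProper (f : Finset V → ℝ) : Prop where
  compl : ∀ S, f Sᶜ = f S
  union : ∀ A B, Disjoint A B → f (A ∪ B) ≤ max (f A) (f B)

/-- Edge weights covering the cut requirement `f`. -/
structure Covers (f : Finset V → ℝ) (z : Sym2 V → ℝ) : Prop where
  nonneg : ∀ e, 0 ≤ z e
  cut : ∀ S, f S ≤ cutVal z S

lemma cutInd_mk (S : Finset V) (a b : V) :
    cutInd S s(a, b) = if (a ∈ S ∧ b ∉ S) ∨ (a ∉ S ∧ b ∈ S) then 1 else 0 := by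
  unfold cutInd
  congr 1
  simp only [Sym2.mem_iff, eq_iff_iff]
  constructor
  · rintro ⟨⟨p, rfl | rfl, hp⟩, q, rfl | rfl, hq⟩ <;> tauto
  · rintro (⟨h1, h2⟩ | ⟨h1, h2⟩)
    · exact ⟨⟨a, by tauto⟩, b, by tauto⟩
    · exact ⟨⟨b, by tauto⟩, a, by tauto⟩

lemma cutInd_nonneg (S : Finset V) (e : Sym2 V) : 0 ≤ cutInd S e := by
  unfold cutInd; split_ifs <;> norm_num

lemma cutInd_compl (S : Finset V) (e : Sym2 V) : cutInd Sᶜ e = cutInd S e := by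
  induction e using Sym2.ind with | _ a b =>
  simp only [cutInd_mk, Finset.mem_compl]
  congr 1
  simp only [eq_iff_iff]; tauto

lemma cutVal_compl (z : Sym2 V → ℝ) (S : Finset V) : cutVal z Sᶜ = cutVal z S := by
  simp [cutVal, cutInd_compl]

lemma cutVal_nonneg {z : Sym2 V → ℝ} (hz : ∀ e, 0 ≤ z e) (S : Finset V) : 0 ≤ cutVal z S :=
  Finset.sum_nonneg fun e _ => mul_nonneg (hz e) (cutInd_nonneg S e)

lemma sum_splitOff_mul (z : Sym2 V → ℝ) (u v w : V) (ε : ℝ) (g : Sym2 V → ℝ) :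
    ∑ e, splitOff z u v w ε e * g e
      = ∑ e, z e * g e - ε * (g s(u, v) + g s(v, w) - g s(u, w)) := by
  simp only [splitOff, add_mul, sub_mul, Finset.sum_add_distrib, Finset.sum_sub_distrib, mul_assoc,
    ite_mul, one_mul, zero_mul, mul_ite, mul_zero, Finset.sum_ite_eq', Finset.mem_univ, if_true]
  ring

lemma cutVal_splitOff (z : Sym2 V → ℝ) (u v w : V) (ε : ℝ) (S : Finset V) :
    cutVal (splitOff z u v w ε) S
      = cutVal z S - ε * (cutInd S s(u, v) + cutInd S s(v, w) - cutInd S s(u, w)) :=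
  sum_splitOff_mul z u v w ε _

lemma cutInd_split_nonneg (S : Finset V) (u v w : V) :
    0 ≤ cutInd S s(u, v) + cutInd S s(v, w) - cutInd S s(u, w) := by
  simp only [cutInd_mk]
  by_cases hu : u ∈ S <;> by_cases hv : v ∈ S <;> by_cases hw : w ∈ S <;> simp [hu, hv, hw]

lemma cutVal_splitOff_le (z : Sym2 V → ℝ) (u v w : V) {ε : ℝ} (hε : 0 ≤ ε) (S : Finset V) :
    cutVal (splitOff z u v w ε) S ≤ cutVal z S := by
  rw [cutVal_splitOff]
  have := mul_nonneg hε (cutInd_split_nonneg S u v w)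
  linarith

lemma cutVal_union_inter (z : Sym2 V → ℝ) (hz : ∀ e, 0 ≤ z e) (A B : Finset V) :
    cutVal z (A ∪ B) + cutVal z (A ∩ B) ≤ cutVal z A + cutVal z B := by
  simp only [cutVal, ← Finset.sum_add_distrib, ← mul_add]
  refine Finset.sum_le_sum fun e _ => mul_le_mul_of_nonneg_left ?_ (hz e)
  induction e using Sym2.ind with | _ a b =>
  simp only [cutInd_mk]
  by_cases h1 : a ∈ A <;> by_cases h2 : a ∈ B <;> by_cases h3 : b ∈ A <;> by_cases h4 : b ∈ B <;>
    simp [h1, h2, h3, h4]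

lemma cutVal_sdiff_sdiff (z : Sym2 V → ℝ) (hz : ∀ e, 0 ≤ z e) (A B : Finset V) (u v : V)
    (hu : u ∈ A ∩ B) (hv : v ∉ A ∪ B) :
    cutVal z (A \ B) + cutVal z (B \ A) + 2 * z s(u, v) ≤ cutVal z A + cutVal z B := by
  have h2 : 2 * z s(u, v) = ∑ e, z e * (if e = s(u, v) then 2 else 0) := by
    simp [mul_comm]
  rw [h2]
  simp only [cutVal, ← Finset.sum_add_distrib, ← mul_add]
  refine Finset.sum_le_sum fun e _ => mul_le_mul_of_nonneg_left ?_ (hz e)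
  simp only [Finset.mem_inter, Finset.mem_union, not_or] at hu hv
  split_ifs with he
  · subst he
    simp only [cutInd_mk]
    simp [hu, hv]; norm_num
  · induction e using Sym2.ind with | _ a b =>
    simp only [cutInd_mk]
    by_cases h1 : a ∈ A <;> by_cases h2 : a ∈ B <;> by_cases h3 : b ∈ A <;>
      by_cases h4 : b ∈ B <;> simp [h1, h2, h3, h4]

lemma IsProper.uncross {f : Finset V → ℝ} (hf : IsProper f) (A B : Finset V) :
    f A + f B ≤ max (f (A ∪ B) + f (A ∩ B)) (f (A \ B) + f (B \ A)) := by
  have hd1 : Disjoint (A \ B) (A ∩ B) := Finset.disjoint_sdiff_inter A B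
  have hd2 : Disjoint (B \ A) (A ∩ B) := by
    rw [Finset.inter_comm]; exact Finset.disjoint_sdiff_inter B A
  have e1 : A = A \ B ∪ A ∩ B := by ext a; simp; tauto
  have e2 : B = B \ A ∪ A ∩ B := by ext a; simp; tauto
  have e3 : Aᶜ = B \ A ∪ (A ∪ B)ᶜ := by ext a; simp; tauto
  have e4 : Bᶜ = A \ B ∪ (A ∪ B)ᶜ := by ext a; simp; tauto
  have h1 : f A ≤ max (f (A \ B)) (f (A ∩ B)) := by
    conv_lhs => rw [e1]
    exact hf.union _ _ hd1
  have h2 : f B ≤ max (f (B \ A)) (f (A ∩ B)) := by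
    conv_lhs => rw [e2]
    exact hf.union _ _ hd2
  have h3 : f A ≤ max (f (B \ A)) (f (A ∪ B)) := by
    rw [← hf.compl A, e3, ← hf.compl (A ∪ B)]
    refine hf.union _ _ ?_
    rw [Finset.disjoint_left]; intro a; simp; tauto
  have h4 : f B ≤ max (f (A \ B)) (f (A ∪ B)) := by
    rw [← hf.compl B, e4, ← hf.compl (A ∪ B)]
    refine hf.union _ _ ?_
    rw [Finset.disjoint_left]; intro a; simp; tauto
  simp only [le_max_iff] at *
  by_contra! hcon
  rcases h1 with h1 | h1 <;> rcases h2 with h2 | h2 <;> rcases h3 with h3 | h3 <;>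
    rcases h4 with h4 | h4 <;> linarith [hcon.1, hcon.2]

lemma IsProper.le_max_insert {f : Finset V → ℝ} (hf : IsProper f) (S : Finset V) {v : V}
    (hv : v ∉ S) : f S ≤ max (f (insert v S)) (f {v}) := by
  have e : Sᶜ = (insert v S)ᶜ ∪ {v} := by
    ext a; simp only [Finset.mem_compl, Finset.mem_union, Finset.mem_insert, Finset.mem_singleton]
    by_cases h : a = v
    · subst h; simp [hv]
    · simp [h]
  rw [← hf.compl S, e, ← hf.compl (insert v S)]
  exact hf.union _ _ (by simp)

/-- If no pair of edges at `v` can be split off, then `v` has at most its required degree. -/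
lemma exists_splittable {f : Finset V → ℝ} (hf : IsProper f) {z : Sym2 V → ℝ} (hz : Covers f z)
    {v : V} (hv : max 0 (f {v}) < cutVal z {v}) :
    ∃ u w, u ≠ v ∧ w ≠ v ∧ 0 < z s(u, v) ∧ 0 < z s(v, w) ∧
      ∀ S : Finset V, v ∉ S → u ∈ S → w ∈ S → f S < cutVal z S := by
  by_contra! hcon
  rw [max_lt_iff] at hv
  set N : Finset V := Finset.univ.filter fun u => u ≠ v ∧ 0 < z s(u, v) with hN
  have key : ∀ X : Finset V, X.Nonempty → X ⊆ N →
      ∃ S : Finset V, v ∉ S ∧ X ⊆ S ∧ cutVal z S = f S := by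
    intro X hX
    induction hX using Finset.Nonempty.cons_induction with
    | singleton a =>
      intro ha
      have ha : a ≠ v ∧ 0 < z s(a, v) := by simpa [hN] using ha
      obtain ⟨S, h1, h2, -, h4⟩ := hcon a a ha.1 ha.1 ha.2 (by rw [Sym2.eq_swap]; exact ha.2)
      exact ⟨S, h1, by simpa using h2, le_antisymm h4 (hz.cut S)⟩
    | cons a s has hs ih =>
      intro hsub
      obtain ⟨A, hA1, hA2, hA3⟩ := ih fun b hb => hsub (Finset.mem_cons_of_mem hb)
      obtain ⟨u, hu⟩ := hs
      have ha : a ≠ v ∧ 0 < z s(a, v) := by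
        simpa [hN] using hsub (Finset.mem_cons_self a s)
      have hu' : u ≠ v ∧ 0 < z s(u, v) := by
        simpa [hN] using hsub (Finset.mem_cons_of_mem hu)
      obtain ⟨B, hB1, hB2, hB3, hB4⟩ := hcon u a hu'.1 ha.1 hu'.2 (by rw [Sym2.eq_swap]; exact ha.2)
      have hB5 := le_antisymm hB4 (hz.cut B)
      have hvu : v ∉ A ∪ B := by simp [hA1, hB1]
      refine ⟨A ∪ B, hvu, ?_, ?_⟩
      · intro b hb
        rcases Finset.mem_cons.1 hb with rfl | hb
        · exact Finset.mem_union_right _ hB3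
        · exact Finset.mem_union_left _ (hA2 hb)
      · have c1 := cutVal_union_inter z hz.nonneg A B
        have c2 := cutVal_sdiff_sdiff z hz.nonneg A B u v
          (Finset.mem_inter.2 ⟨hA2 hu, hB2⟩) hvu
        have d1 := hz.cut (A ∪ B)
        have d2 := hz.cut (A ∩ B)
        have d3 := hz.cut (A \ B)
        have d4 := hz.cut (B \ A)
        rcases le_max_iff.1 (hf.uncross A B) with h | h <;> linarith [hu'.2]
  have hNne : N.Nonempty := by
    by_contra hNe
    have hNe : ∀ u, u ≠ v → z s(u, v) ≤ 0 := by
      intro u hu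
      by_contra! h
      exact hNe ⟨u, by simp [hN, hu, h]⟩
    have : cutVal z {v} ≤ 0 := by
      refine Finset.sum_nonpos fun e _ => ?_
      induction e using Sym2.ind with | _ a b =>
      simp only [cutInd_mk, Finset.mem_singleton]
      split_ifs with h
      · rcases h with ⟨rfl, h⟩ | ⟨h, rfl⟩
        · have := hNe b h; rw [Sym2.eq_swap] at this; linarith
        · have := hNe a h; linarith
      · simp
    linarith [hv.1]
  obtain ⟨S, hS1, hS2, hS3⟩ := key N hNne subset_rfl
  have hcut : cutVal z (insert v S) + cutVal z {v} ≤ cutVal z S := by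
    simp only [cutVal, ← Finset.sum_add_distrib, ← mul_add]
    refine Finset.sum_le_sum fun e _ => ?_
    rcases (hz.nonneg e).eq_or_lt with h0 | h0
    · simp [← h0]
    refine mul_le_mul_of_nonneg_left ?_ h0.le
    induction e using Sym2.ind with | _ a b =>
    have hmem : ∀ u, u ≠ v → 0 < z s(u, v) → u ∈ S := fun u h1 h2 => hS2 (by simp [hN, h1, h2])
    simp only [cutInd_mk, Finset.mem_insert, Finset.mem_singleton]
    by_cases hav : a = v
    · subst hav
      by_cases hbv : b = a
      · simp [hbv]
      · have := hmem b hbv (by rwa [Sym2.eq_swap])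
        simp [hbv, this, hS1]
    · by_cases hbv : b = v
      · subst hbv
        have := hmem a hav h0
        simp [hav, this, hS1]
      · simp [hav, hbv]
  have := cutVal_nonneg hz.nonneg (insert v S)
  have := hz.cut (insert v S)
  rcases le_max_iff.1 (hf.le_max_insert S hS1) with h | h <;> linarith

/-- First time at which one of finitely many affine functions vanishes. -/
lemma exists_first_zero {ι : Type*} [Fintype ι] (a b : ι → ℝ) (ha : ∀ i, 0 ≤ a i)
    (hb : ∃ i, b i < 0) :
    ∃ t : ℝ, 0 ≤ t ∧ (∀ i, 0 ≤ a i + t * b i) ∧ ∃ j, b j < 0 ∧ a j + t * b j = 0 := by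
  classical
  obtain ⟨i₀, hi₀⟩ := hb
  obtain ⟨j, hj, hmin⟩ := Finset.exists_min_image (Finset.univ.filter fun i => b i < 0)
    (fun i => a i / (-b i)) ⟨i₀, by simpa using hi₀⟩
  have hj : b j < 0 := by simpa using hj
  have ht : 0 ≤ a j / (-b j) := div_nonneg (ha j) (by linarith)
  refine ⟨a j / (-b j), ht, fun i => ?_, j, hj, ?_⟩
  · rcases le_or_gt 0 (b i) with h | h
    · exact add_nonneg (ha i) (mul_nonneg ht h)
    · have := hmin i (by simpa using h)
      rw [le_div_iff₀ (by linarith)] at this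
      linarith
  · have : b j ≠ 0 := hj.ne
    field_simp
    ring

/-- Complete splitting off at a vertex, as an induction principle. -/
theorem splitOff_induction {f : Finset V → ℝ} (hf : IsProper f) (v : V)
    (Good : (Sym2 V → ℝ) → Prop)
    (base : ∀ z, Covers f z → cutVal z {v} ≤ max 0 (f {v}) → Good z)
    (step : ∀ z u w ε, Covers f z → 0 ≤ ε → u ≠ v → w ≠ v → Covers f (splitOff z u v w ε) →
      Good (splitOff z u v w ε) → Good z) :
    ∀ z, Covers f z → Good z := by
  classical
  set P : (Sym2 V → ℝ) → V × V → Prop := fun z p => p.1 ≠ v ∧ p.2 ≠ v ∧ 0 < z s(p.1, v) ∧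
    0 < z s(v, p.2) ∧ ∀ S : Finset V, v ∉ S → p.1 ∈ S → p.2 ∈ S → f S < cutVal z S with hP
  suffices ∀ n, ∀ z, Covers f z → (Finset.univ.filter (P z)).card = n → Good z from
    fun z hz => this _ z hz rfl
  intro n
  induction n using Nat.strong_induction_on with | _ n ih =>
  intro z hz hn
  rcases le_or_gt (cutVal z {v}) (max 0 (f {v})) with hle | hlt
  · exact base z hz hle
  obtain ⟨u, w, hu, hw, hzu, hzw, hS⟩ := exists_splittable hf hz hlt
  obtain ⟨ε, hε, hall, j, hj, hj0⟩ := exists_first_zero (ι := Sym2 V ⊕ Finset V)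
    (Sum.elim z fun S => cutVal z S - f S)
    (Sum.elim (fun e => (if e = s(u, w) then 1 else 0) - (if e = s(u, v) then 1 else 0)
        - (if e = s(v, w) then 1 else 0))
      fun S => -(cutInd S s(u, v) + cutInd S s(v, w) - cutInd S s(u, w)))
    (by rintro (e | S)
        · exact hz.nonneg e
        · simpa using hz.cut S)
    ⟨Sum.inl s(u, v), by
      have h1 : s(u, v) ≠ s(u, w) := by simp [hw.symm, Ne.symm hu]
      simp only [Sum.elim_inl, h1, if_false, if_true]
      split_ifs <;> norm_num⟩
  set z' := splitOff z u v w ε with hz'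
  have hz'e : ∀ e, z' e = z e + ε * ((if e = s(u, w) then 1 else 0) - (if e = s(u, v) then 1 else 0)
        - (if e = s(v, w) then 1 else 0)) := by
    intro e; simp only [hz', splitOff]; ring
  have hcov : Covers f z' := by
    refine ⟨fun e => ?_, fun S => ?_⟩
    · rw [hz'e]; simpa using hall (Sum.inl e)
    · have := hall (Sum.inr S)
      simp only [Sum.elim_inr] at this
      rw [hz', cutVal_splitOff]; linarith
  have hle : ∀ a, a ≠ v → z' s(a, v) ≤ z s(a, v) := by
    intro a ha
    have h1 : s(a, v) ≠ s(u, w) := by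
      simp only [ne_eq, Sym2.eq_iff, not_or, not_and]
      exact ⟨fun _ h => hw h.symm, fun _ h => hu h.symm⟩
    rw [hz'e, if_neg h1]
    have : (0:ℝ) ≤ (if s(a, v) = s(u, v) then 1 else 0) := by split_ifs <;> norm_num
    have : (0:ℝ) ≤ (if s(a, v) = s(v, w) then 1 else 0) := by split_ifs <;> norm_num
    nlinarith
  refine step z u w ε hz hε hu hw hcov (ih _ ?_ z' hcov rfl)
  rw [← hn]
  refine Finset.card_lt_card ⟨?_, ?_⟩
  · intro p
    simp only [Finset.mem_filter, Finset.mem_univ, true_and, hP]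
    rintro ⟨h1, h2, h3, h4, h5⟩
    refine ⟨h1, h2, h3.trans_le (hle _ h1), ?_, fun S a b c => (h5 S a b c).trans_le
      (cutVal_splitOff_le z u v w hε S)⟩
    rw [Sym2.eq_swap] at h4 ⊢
    exact h4.trans_le (hle _ h2)
  · intro hsub
    have hmem : (u, w) ∈ Finset.univ.filter (P z) := by
      simp only [Finset.mem_filter, Finset.mem_univ, true_and, hP]
      exact ⟨hu, hw, hzu, hzw, hS⟩
    have hmem := hsub hmem
    simp only [Finset.mem_filter, Finset.mem_univ, true_and, hP] at hmem
    obtain ⟨-, -, h3, h4, h5⟩ := hmem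
    rcases j with e | S
    · simp only [Sum.elim_inl] at hj hj0
      rw [← hz'e] at hj0
      have : e = s(u, v) ∨ e = s(v, w) := by
        by_contra! hne
        rw [if_neg hne.1, if_neg hne.2] at hj
        split_ifs at hj <;> norm_num at hj
      rcases this with rfl | rfl <;> linarith
    · simp only [Sum.elim_inr] at hj hj0
      have hj0' : cutVal z' S = f S := by rw [hz', cutVal_splitOff]; linarith
      have hsep : (v ∉ S ∧ u ∈ S ∧ w ∈ S) ∨ (v ∈ S ∧ u ∉ S ∧ w ∉ S) := by
        simp only [cutInd_mk] at hj
        by_cases hu : u ∈ S <;> by_cases hv : v ∈ S <;> by_cases hw : w ∈ S <;>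
          simp [hu, hv, hw] at hj ⊢
      rcases hsep with ⟨a, b, c⟩ | ⟨a, b, c⟩
      · linarith [h5 S a b c]
      · have := h5 Sᶜ (by simpa using a) (by simpa using b) (by simpa using c)
        rw [cutVal_compl, hf.compl] at this
        linarith

/-- Splitting off at every vertex of `X` at no cost. -/
theorem exists_splitOff_cheap {f : Finset V → ℝ} (hf : IsProper f) (c : Sym2 V → ℝ)
    (hc : ∀ u v w, c s(u, w) ≤ c s(u, v) + c s(v, w)) (z : Sym2 V → ℝ) (hz : Covers f z) :
    ∃ z', Covers f z' ∧ ∑ e, z' e * c e ≤ ∑ e, z e * c e ∧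
      ∀ v, cutVal z' {v} ≤ max 0 (f {v}) := by
  suffices ∀ X : Finset V, ∃ z', Covers f z' ∧ ∑ e, z' e * c e ≤ ∑ e, z e * c e ∧
      ∀ v ∈ X, cutVal z' {v} ≤ max 0 (f {v}) by
    simpa using this Finset.univ
  intro X
  induction X using Finset.induction_on with
  | empty => exact ⟨z, hz, le_rfl, by simp⟩
  | insert a X _ ih =>
    obtain ⟨z₁, h1, h2, h3⟩ := ih
    have := splitOff_induction hf a (fun x => ∃ z', Covers f z' ∧
      ∑ e, z' e * c e ≤ ∑ e, x e * c e ∧ (∀ v, cutVal z' {v} ≤ cutVal x {v}) ∧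
      cutVal z' {a} ≤ max 0 (f {a}))
      (fun x hx hxa => ⟨x, hx, le_rfl, fun _ => le_rfl, hxa⟩)
      (by
        rintro x u w ε - hε - - - ⟨z', a1, a2, a3, a4⟩
        refine ⟨z', a1, a2.trans ?_, fun v => (a3 v).trans (cutVal_splitOff_le x u a w hε _), a4⟩
        rw [sum_splitOff_mul]
        nlinarith [hc u a w]) z₁ h1
    obtain ⟨z', a1, a2, a3, a4⟩ := this
    refine ⟨z', a1, a2.trans h2, fun v hv => ?_⟩
    rcases Finset.mem_insert.1 hv with rfl | hv
    · exact a4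
    · exact (a3 v).trans (h3 v hv)

end Splitting

open scoped NNReal

section TreeDistributions

variable {V : Type*} [Fintype V] [DecidableEq V]

/-- Reachability along the edges of `T`. -/
def Reach (T : Finset (Sym2 V)) : V → V → Prop := Relation.ReflTransGen fun a b => s(a, b) ∈ T

lemma Reach.symm {T : Finset (Sym2 V)} {a b : V} (h : Reach T a b) : Reach T b a := by
  have : Std.Symm fun a b : V => s(a, b) ∈ T := ⟨fun a b h => by rwa [Sym2.eq_swap]⟩
  exact Relation.ReflTransGen.stdSymm.symm _ _ h

lemma Reach.of_mem {T : Finset (Sym2 V)} {a b : V} (h : s(a, b) ∈ T) : Reach T a b :=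
  Relation.ReflTransGen.single h

lemma Reach.trans {T : Finset (Sym2 V)} {a b d : V} (h : Reach T a b) (h' : Reach T b d) :
    Reach T a d :=
  Relation.ReflTransGen.trans h h'

lemma Reach.simulate {T T' : Finset (Sym2 V)} (hT : ∀ a b, s(a, b) ∈ T → Reach T' a b) {a b : V}
    (h : Reach T a b) : Reach T' a b := by
  induction h with
  | refl => exact Relation.ReflTransGen.refl
  | tail _ h ih => exact ih.trans (hT _ _ h)

lemma Reach.mono {T T' : Finset (Sym2 V)} (hT : T ⊆ T') {a b : V} (h : Reach T a b) :
    Reach T' a b :=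
  h.simulate fun _ _ h => Reach.of_mem (hT h)

/-- Indicator of containing an edge. -/
def inT (e : Sym2 V) (T : Finset (Sym2 V)) : ℝ := if e ∈ T then 1 else 0

/-- Indicator of connecting `u` to the root. -/
noncomputable def cov (r u : V) (T : Finset (Sym2 V)) : ℝ :=
  open Classical in if Reach T r u then 1 else 0

/-- The degree of `v` in `T`, ignoring loops. -/
def degT (v : V) (T : Finset (Sym2 V)) : ℝ := ∑ a ∈ Finset.univ.erase v, inT s(a, v) T

lemma inT_nonneg (e : Sym2 V) (T : Finset (Sym2 V)) : 0 ≤ inT e T := by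
  unfold inT; split_ifs <;> norm_num

lemma inT_mono (e : Sym2 V) {T T' : Finset (Sym2 V)} (h : T ⊆ T') : inT e T ≤ inT e T' := by
  unfold inT; split_ifs with h1 h2 <;> first | exact absurd (h h1) h2 | norm_num

lemma inT_insert_le (e e' : Sym2 V) (T : Finset (Sym2 V)) :
    inT e (insert e' T) ≤ inT e T + if e = e' then 1 else 0 := by
  unfold inT
  by_cases h1 : e = e'
  · simp only [h1, Finset.mem_insert_self, if_true]
    split_ifs <;> norm_num
  · by_cases h2 : e ∈ T <;> simp [h1, h2]

lemma cov_nonneg (r u : V) (T : Finset (Sym2 V)) : 0 ≤ cov r u T := by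
  unfold cov; split_ifs <;> norm_num

lemma cov_le_one (r u : V) (T : Finset (Sym2 V)) : cov r u T ≤ 1 := by
  unfold cov; split_ifs <;> norm_num

lemma cov_self (r : V) (T : Finset (Sym2 V)) : cov r r T = 1 := by
  unfold cov; exact if_pos Relation.ReflTransGen.refl

lemma cov_le_cov {r u u' : V} {T T' : Finset (Sym2 V)} (h : Reach T r u → Reach T' r u') :
    cov r u T ≤ cov r u' T' := by
  unfold cov; split_ifs with h1 h2 <;> first | exact absurd (h h1) h2 | norm_num

lemma degT_mono (v : V) {T T' : Finset (Sym2 V)} (h : T ⊆ T') : degT v T ≤ degT v T' :=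
  Finset.sum_le_sum fun _ _ => inT_mono _ h

lemma degT_insert_le (v u : V) (T : Finset (Sym2 V)) :
    degT v (insert s(u, v) T) ≤ degT v T + 1 := by
  unfold degT
  refine (Finset.sum_le_sum fun a _ => inT_insert_le s(a, v) s(u, v) T).trans ?_
  rw [Finset.sum_add_distrib]
  gcongr
  have : ∀ a ∈ Finset.univ.erase v, (if s(a, v) = s(u, v) then (1:ℝ) else 0)
      = if a = u then 1 else 0 := by
    intro a ha
    congr 1
    simp only [eq_iff_iff, Sym2.eq_iff]
    constructor
    · rintro (h | h)
      · exact h.1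
      · exact absurd h.1 (Finset.ne_of_mem_erase ha)
    · rintro rfl; simp
  rw [Finset.sum_congr rfl this, Finset.sum_ite_eq']
  split_ifs <;> norm_num

/-- A probability distribution. -/
structure IsDist {α : Type*} [Fintype α] (p : α → ℝ) : Prop where
  nonneg : ∀ a, 0 ≤ p a
  sum : ∑ a, p a = 1

/-- Expectation. -/
def expec {α : Type*} [Fintype α] (p : α → ℝ) (φ : α → ℝ) : ℝ := ∑ a, p a * φ a

/-- With probability `q`, apply `g`. -/
def mix {α : Type*} [Fintype α] [DecidableEq α] (p : α → ℝ) (g : α → α) (q : ℝ) : α → ℝ :=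
  fun a => (1 - q) * p a + q * ∑ b, if g b = a then p b else 0

section
variable {α : Type*} [Fintype α] [DecidableEq α]

lemma expec_mono {p : α → ℝ} (hp : IsDist p) {φ ψ : α → ℝ} (h : ∀ a, φ a ≤ ψ a) :
    expec p φ ≤ expec p ψ :=
  Finset.sum_le_sum fun a _ => mul_le_mul_of_nonneg_left (h a) (hp.nonneg a)

lemma expec_add (p φ ψ : α → ℝ) : expec p (fun a => φ a + ψ a) = expec p φ + expec p ψ := by
  simp [expec, mul_add, Finset.sum_add_distrib]

lemma expec_sub (p φ ψ : α → ℝ) : expec p (fun a => φ a - ψ a) = expec p φ - expec p ψ := by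
  simp [expec, mul_sub, Finset.sum_sub_distrib]

lemma expec_const {p : α → ℝ} (hp : IsDist p) (k : ℝ) : expec p (fun _ => k) = k := by
  simp [expec, ← Finset.sum_mul, hp.sum]

lemma expec_sum {β : Type*} (p : α → ℝ) (s : Finset β) (φ : β → α → ℝ) :
    expec p (fun a => ∑ b ∈ s, φ b a) = ∑ b ∈ s, expec p (φ b) := by
  simp only [expec, Finset.mul_sum]
  exact Finset.sum_comm

lemma expec_mul_left (p : α → ℝ) (k : ℝ) (φ : α → ℝ) :
    expec p (fun a => k * φ a) = k * expec p φ := by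
  simp only [expec, Finset.mul_sum]
  exact Finset.sum_congr rfl fun _ _ => by ring

lemma expec_mix (p : α → ℝ) (g : α → α) (q : ℝ) (φ : α → ℝ) :
    expec (mix p g q) φ = (1 - q) * expec p φ + q * expec p (fun a => φ (g a)) := by
  simp only [expec, mix, add_mul, Finset.sum_add_distrib, Finset.mul_sum, mul_assoc]
  congr 1
  simp only [mul_ite, mul_zero, Finset.sum_mul]
  rw [Finset.sum_comm]
  refine Finset.sum_congr rfl fun b _ => ?_
  simp [ite_mul, mul_assoc]

lemma isDist_mix {p : α → ℝ} (hp : IsDist p) (g : α → α) {q : ℝ} (h0 : 0 ≤ q) (h1 : q ≤ 1) :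
    IsDist (mix p g q) := by
  refine ⟨fun a => ?_, ?_⟩
  · refine add_nonneg (mul_nonneg (by linarith) (hp.nonneg a)) (mul_nonneg h0 ?_)
    refine Finset.sum_nonneg fun b _ => ?_
    split_ifs
    exacts [hp.nonneg b, le_rfl]
  · have := expec_mix p g q fun _ => 1
    have h := hp.sum
    simp only [expec, mul_one, h] at this
    linarith

lemma exists_le_expec {p : α → ℝ} (hp : IsDist p) {φ : α → ℝ} {k : ℝ} (h : expec p φ ≤ k) :
    ∃ a, 0 < p a ∧ φ a ≤ k := by
  by_contra! hcon
  have hlt : ∀ a, p a * k ≤ p a * φ a := fun a => by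
    rcases (hp.nonneg a).eq_or_lt with h0 | h0
    · simp [← h0]
    · exact mul_le_mul_of_nonneg_left (hcon a h0).le h0.le
  obtain ⟨a, ha⟩ : ∃ a, 0 < p a := by
    by_contra! h0
    have := Finset.sum_nonpos fun a (_ : a ∈ Finset.univ) => h0 a
    linarith [hp.sum]
  have h1 : ∑ a, p a * k < ∑ a, p a * φ a :=
    Finset.sum_lt_sum (fun a _ => hlt a) ⟨a, Finset.mem_univ a,
      mul_lt_mul_of_pos_left (hcon a ha) ha⟩
  rw [← Finset.sum_mul, hp.sum, one_mul] at h1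
  exact absurd h (not_le.2 h1)

end

/-- The cut requirement of the LP relaxation. -/
noncomputable def req (r : V) (y : V → ℝ) (S : Finset V) : ℝ :=
  2 * (((if r ∈ S then Sᶜ else S).sup fun v => (y v).toNNReal : ℝ≥0) : ℝ)

lemma isProper_req (r : V) (y : V → ℝ) : IsProper (req r y) := by
  refine ⟨fun S => ?_, fun A B hAB => ?_⟩
  · unfold req
    by_cases h : r ∈ S <;> simp [h]
  · unfold req
    rw [← mul_max_of_nonneg _ _ (by norm_num : (0:ℝ) ≤ 2), ← NNReal.coe_max]
    refine mul_le_mul_of_nonneg_left (NNReal.coe_le_coe.2 ?_) (by norm_num)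
    by_cases hA : r ∈ A
    · rw [if_pos (Finset.mem_union_left _ hA), if_pos hA]
      refine le_max_of_le_left (Finset.sup_mono ?_)
      exact Finset.compl_subset_compl.2 Finset.subset_union_left
    · by_cases hB : r ∈ B
      · rw [if_pos (Finset.mem_union_right _ hB), if_pos hB]
        refine le_max_of_le_right (Finset.sup_mono ?_)
        exact Finset.compl_subset_compl.2 Finset.subset_union_right
      · rw [if_neg hA, if_neg hB, if_neg (by simp [hA, hB]), Finset.sup_union]

lemma req_le_iff {r : V} {y : V → ℝ} {S : Finset V} (hr : r ∉ S) {b : ℝ} (hb : 0 ≤ b) :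
    req r y S ≤ b ↔ ∀ v ∈ S, 2 * y v ≤ b := by
  unfold req
  rw [if_neg hr, ← le_div_iff₀' (by norm_num : (0:ℝ) < 2), ← Real.le_toNNReal_iff_coe_le (by positivity),
    Finset.sup_le_iff]
  refine forall₂_congr fun v _ => ?_
  rw [Real.toNNReal_le_toNNReal_iff (by positivity), le_div_iff₀' (by norm_num : (0:ℝ) < 2)]

lemma covers_req_iff {r : V} {y : V → ℝ} {x : Sym2 V → ℝ} :
    Covers (req r y) x ↔ (∀ e, 0 ≤ x e) ∧
      ∀ S : Finset V, r ∉ S → ∀ v ∈ S, 2 * y v ≤ cutVal x S := by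
  constructor
  · intro h
    exact ⟨h.nonneg, fun S hS => (req_le_iff hS (cutVal_nonneg h.nonneg S)).1 (h.cut S)⟩
  · rintro ⟨h0, h⟩
    refine ⟨h0, fun S => ?_⟩
    by_cases hr : r ∈ S
    · rw [← (isProper_req r y).compl, ← cutVal_compl]
      exact (req_le_iff (by simpa using hr) (cutVal_nonneg h0 _)).2 (h _ (by simpa using hr))
    · exact (req_le_iff hr (cutVal_nonneg h0 _)).2 (h _ hr)

lemma cutVal_singleton (x : Sym2 V → ℝ) (v : V) :
    cutVal x {v} = ∑ a ∈ Finset.univ.erase v, x s(a, v) := by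
  have h1 : ∀ e, x e * cutInd {v} e
      = ∑ a ∈ Finset.univ.erase v, if e = s(a, v) then x e else 0 := by
    intro e
    induction e using Sym2.ind with | _ a b =>
    rw [cutInd_mk]
    simp only [Finset.mem_singleton]
    by_cases ha : a = v
    · subst ha
      by_cases hb : b = a
      · subst hb
        rw [Finset.sum_eq_zero]
        · simp
        · intro d hd
          rw [if_neg]
          simp only [Sym2.eq_iff, not_or, not_and]
          exact ⟨fun h => absurd h.symm (Finset.ne_of_mem_erase hd),
            fun _ h => absurd h.symm (Finset.ne_of_mem_erase hd)⟩
      · rw [Finset.sum_eq_single b]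
        · simp [hb]
        · intro d hd hdb
          rw [if_neg]
          simp only [Sym2.eq_iff, not_or, not_and]
          exact ⟨fun h => absurd h.symm (Finset.ne_of_mem_erase hd), fun _ h => hdb h.symm⟩
        · intro h; simp [hb] at h
    · by_cases hb : b = v
      · subst hb
        rw [Finset.sum_eq_single a]
        · simp [ha]
        · intro d hd hdb
          rw [if_neg]
          simp only [Sym2.eq_iff, not_or, not_and]
          exact ⟨fun h => absurd h.symm hdb, fun h => absurd h ha⟩
        · intro h; simp [ha] at h
      · rw [Finset.sum_eq_zero]
        · simp [ha, hb]
        · intro d hd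
          rw [if_neg]
          simp only [Sym2.eq_iff, not_or, not_and]
          exact ⟨fun _ => hb, fun h => absurd h ha⟩
  simp only [cutVal, h1]
  rw [Finset.sum_comm]
  simp

lemma expec_degT (p : Finset (Sym2 V) → ℝ) (v : V) :
    expec p (degT v) = ∑ a ∈ Finset.univ.erase v, expec p (inT s(a, v)) :=
  expec_sum p _ fun a => inT s(a, v)

lemma Reach.erase_left {T : Finset (Sym2 V)} {r u w v a : V} 
    (hu : Reach (T.erase s(u, w)) r u) (hv : Reach T r v) 
    (ha : a = v) :
    Reach (T.erase s(u, w)) r a ∨ Reach (T.erase s(u, w)) w a := by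
  subst ha
  induction hv with
  | refl => exact Or.inl Relation.ReflTransGen.refl
  | @tail b d _ h ih =>
    by_cases hbd : s(b, d) = s(u, w)
    · rcases Sym2.eq_iff.1 hbd with ⟨-, rfl⟩ | ⟨-, rfl⟩
      · exact Or.inr Relation.ReflTransGen.refl
      · exact Or.inl hu
    · have h' : Reach (T.erase s(u, w)) b d := Reach.of_mem (Finset.mem_erase.2 ⟨hbd, h⟩)
      exact ih.imp (fun h => h.trans h') fun h => h.trans h'

lemma Reach.of_erase {T T' : Finset (Sym2 V)} {u w : V} (hsub : T.erase s(u, w) ⊆ T')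
    (huw : Reach T' u w) {a b : V} (h : Reach T a b) : Reach T' a b := by
  refine h.simulate fun a b hab => ?_
  by_cases h' : s(a, b) = s(u, w)
  · rcases Sym2.eq_iff.1 h' with ⟨rfl, rfl⟩ | ⟨rfl, rfl⟩
    · exact huw
    · exact huw.symm
  · exact Reach.of_mem (hsub (Finset.mem_erase.2 ⟨h', hab⟩))

/-- Rerouting an edge `uw` of a tree through `v`. -/
lemma exists_reroute (r u v w : V) (hu : u ≠ v) (hw : w ≠ v) (T : Finset (Sym2 V)) :
    ∃ T' : Finset (Sym2 V), (∀ a, Reach T r a → Reach T' r a) ∧ T' ⊆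
      insert s(u, v) (insert s(v, w) (T.erase s(u, w))) ∧
      degT v T' ≤ degT v T + 1 + cov r v T' - cov r v T := by
  set T₀ := T.erase s(u, w) with hT₀
  have hd0 : degT v T₀ ≤ degT v T := degT_mono v (Finset.erase_subset _ _)
  have hd1 : degT v (insert s(u, v) T₀) ≤ degT v T + 1 := by
    linarith [degT_insert_le v u T₀]
  have hd2 : degT v (insert s(v, w) T₀) ≤ degT v T + 1 := by
    have := degT_insert_le v w T₀
    rw [Sym2.eq_swap] at this; linarith
  have hcov : ∀ {T' : Finset (Sym2 V)}, (∀ a, Reach T r a → Reach T' r a) →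
      cov r v T ≤ cov r v T' := fun h => cov_le_cov (h v)
  have s1 : insert s(u, v) T₀ ⊆ insert s(u, v) (insert s(v, w) T₀) :=
    Finset.insert_subset_insert _ (Finset.subset_insert _ _)
  have s2 : insert s(v, w) T₀ ⊆ insert s(u, v) (insert s(v, w) T₀) := Finset.subset_insert _ _
  have m1 : Reach (insert s(u, v) T₀) u v := Reach.of_mem (Finset.mem_insert_self _ _)
  have m2 : Reach (insert s(v, w) T₀) v w := Reach.of_mem (Finset.mem_insert_self _ _)
  by_cases hv : Reach T r v
  · by_cases hu' : Reach T₀ r u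
    · rcases Reach.erase_left hu' hv rfl with h | h
      · have hr : ∀ a, Reach T r a → Reach (insert s(v, w) T₀) r a := fun a =>
          Reach.of_erase (Finset.subset_insert _ _) (((hu'.symm.trans h).mono
            (Finset.subset_insert _ _)).trans m2)
        exact ⟨_, hr, s2, by linarith [hcov hr]⟩
      · have hr : ∀ a, Reach T r a → Reach (insert s(u, v) T₀) r a := fun a =>
          Reach.of_erase (Finset.subset_insert _ _)
            (m1.trans (h.symm.mono (Finset.subset_insert _ _)))
        exact ⟨_, hr, s1, by linarith [hcov hr]⟩
    · by_cases hw' : Reach T₀ r w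
      · have hw'' : Reach (T.erase s(w, u)) r w := by rwa [Sym2.eq_swap]
        have h := Reach.erase_left hw'' hv rfl
        rw [Sym2.eq_swap, ← hT₀] at h
        rcases h with h | h
        · have hr : ∀ a, Reach T r a → Reach (insert s(u, v) T₀) r a := fun a =>
            Reach.of_erase (Finset.subset_insert _ _)
              (m1.trans ((h.symm.trans hw').mono (Finset.subset_insert _ _)))
          exact ⟨_, hr, s1, by linarith [hcov hr]⟩
        · have hr : ∀ a, Reach T r a → Reach (insert s(v, w) T₀) r a := fun a =>
            Reach.of_erase (Finset.subset_insert _ _)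
              ((h.mono (Finset.subset_insert _ _)).trans m2)
          exact ⟨_, hr, s2, by linarith [hcov hr]⟩
      · have hr : ∀ a, Reach T r a → Reach T₀ r a := by
          intro a ha
          induction ha with
          | refl => exact Relation.ReflTransGen.refl
          | @tail b d _ h ih =>
            refine ih.trans (Reach.of_mem (Finset.mem_erase.2 ⟨fun hbd => ?_, h⟩))
            rcases Sym2.eq_iff.1 hbd with ⟨rfl, -⟩ | ⟨rfl, -⟩
            · exact hu' ih
            · exact hw' ih
        exact ⟨T₀, hr, (Finset.subset_insert _ _).trans s1, by linarith [hcov hr]⟩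
  · have hc0 : cov r v T = 0 := if_neg hv
    by_cases hu' : Reach T r u
    · have hr : ∀ a, Reach T r a → Reach (insert s(u, v) (insert s(v, w) T₀)) r a := fun a =>
        Reach.of_erase ((Finset.subset_insert _ _).trans s1) ((m1.mono s1).trans (m2.mono s2))
      have hc1 : cov r v (insert s(u, v) (insert s(v, w) T₀)) = 1 :=
        if_pos ((hr u hu').trans (m1.mono s1))
      refine ⟨_, hr, subset_rfl, ?_⟩
      have := degT_insert_le v u (insert s(v, w) T₀)
      linarith
    · have hr : ∀ a, Reach T r a → Reach T₀ r a := by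
        intro a ha
        induction ha with
        | refl => exact Relation.ReflTransGen.refl
        | @tail b d hb h ih =>
          refine ih.trans (Reach.of_mem (Finset.mem_erase.2 ⟨fun hbd => ?_, h⟩))
          rcases Sym2.eq_iff.1 hbd with ⟨rfl, -⟩ | ⟨-, rfl⟩
          · exact hu' hb
          · exact hu' (hb.tail h)
      exact ⟨T₀, hr, (Finset.subset_insert _ _).trans s1, by linarith [hcov hr]⟩

/-- Edge marginals bounded by `x`, coverage at least `y` away from `v`. -/
structure Packs (r v : V) (x : Sym2 V → ℝ) (y : V → ℝ) (p : Finset (Sym2 V) → ℝ) : Prop where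
  dist : IsDist p
  edge : ∀ e, ¬ e.IsDiag → expec p (inT e) ≤ x e
  vertex : ∀ u, u ≠ v → y u ≤ expec p (cov r u)
  deg : expec p (degT v) ≤ cutVal x {v} / 2 + expec p (cov r v)

lemma Packs.unsplit {r v : V} {x : Sym2 V → ℝ} {y : V → ℝ} {p : Finset (Sym2 V) → ℝ} {u w : V}
    {ε : ℝ} (hε : 0 ≤ ε) (hu : u ≠ v) (hw : w ≠ v) (hx : ∀ e, 0 ≤ x e)
    (hp : Packs r v (splitOff x u v w ε) y p) : ∃ p', Packs r v x y p' := by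
  have hcut : cutVal (splitOff x u v w ε) {v} = cutVal x {v} - 2 * ε := by
    rw [cutVal_splitOff]
    simp [cutInd_mk, hu, hw]; ring
  have hle : ∀ e, e ≠ s(u, w) → splitOff x u v w ε e ≤ x e := by
    intro e he
    simp only [splitOff, if_neg he]
    split_ifs <;> linarith
  by_cases huw : u = w
  · subst huw
    refine ⟨p, hp.dist, fun e he => (hp.edge e he).trans (hle e ?_), hp.vertex, ?_⟩
    · rintro rfl; exact he rfl
    · have := hp.deg; rw [hcut] at this; linarith
  · have n1 : s(u, w) ≠ s(u, v) := by simp [hw, hu]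
    have n2 : s(u, w) ≠ s(v, w) := by simp [hu, huw, hw]
    have n3 : s(u, v) ≠ s(v, w) := by simp [hu, huw]
    choose g hg1 hg2 hg3 using exists_reroute r u v w hu hw
    set G : Finset (Sym2 V) → Finset (Sym2 V) := fun T => if s(u, w) ∈ T then g T else T with hG
    have G1 : ∀ T a, Reach T r a → Reach (G T) r a := by
      intro T a h; simp only [hG]; split_ifs
      exacts [hg1 T a h, h]
    have G2 : ∀ T, degT v (G T) ≤ degT v T + inT s(u, w) T + cov r v (G T) - cov r v T := by
      intro T; simp only [hG, inT]; split_ifs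
      exacts [hg3 T, by linarith]
    have G3 : ∀ T e, inT e (G T) ≤ (if e = s(u, w) then 0 else inT e T) +
        (if e = s(u, v) then inT s(u, w) T else 0) + (if e = s(v, w) then inT s(u, w) T else 0) := by
      intro T e
      by_cases hT : s(u, w) ∈ T
      · have hGT : G T = g T := if_pos hT
        have h1 : inT s(u, w) T = 1 := if_pos hT
        rw [hGT, h1]
        unfold inT
        by_cases he : e ∈ g T
        · have := hg2 T he
          rw [Finset.mem_insert, Finset.mem_insert, Finset.mem_erase] at this
          rcases this with rfl | rfl | ⟨h3, h4⟩
          · rw [if_pos he, if_neg n1.symm, if_pos rfl, if_neg n3]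
            split_ifs <;> norm_num
          · rw [if_pos he, if_neg n2.symm, if_pos rfl, if_neg n3.symm]
            split_ifs <;> norm_num
          · rw [if_pos he, if_neg h3, if_pos h4]
            split_ifs <;> norm_num
        · rw [if_neg he]
          split_ifs <;> norm_num
      · have hGT : G T = T := if_neg hT
        have h1 : inT s(u, w) T = 0 := if_neg hT
        rw [hGT, h1]
        by_cases he : e = s(u, w)
        · subst he; simp [h1]
        · simp [he]
    set m := splitOff x u v w ε s(u, w) with hm
    have hmx : m = x s(u, w) + ε := by
      simp [hm, splitOff, n1, n2]
    have hm0 : 0 ≤ m := by linarith [hx s(u, w)]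
    set q := ε / m with hq
    have hq0 : 0 ≤ q := div_nonneg hε hm0
    have hqm : q * m = ε := by
      rcases hm0.eq_or_lt with h | h
      · have : ε = 0 := by linarith [hx s(u, w)]
        simp [hq, this]
      · exact div_mul_cancel₀ _ h.ne'
    have hq1 : q ≤ 1 := by
      refine div_le_one_of_le₀ ?_ hm0
      linarith [hx s(u, w)]
    have hedge : ∀ e, expec p (fun T => inT e (G T)) ≤ (if e = s(u, w) then 0 else expec p (inT e)) +
        (if e = s(u, v) then expec p (inT s(u, w)) else 0) +
        (if e = s(v, w) then expec p (inT s(u, w)) else 0) := by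
      intro e
      refine (expec_mono hp.dist fun T => G3 T e).trans (le_of_eq ?_)
      rw [expec_add, expec_add]
      congr 1
      · congr 1
        · split_ifs
          exacts [expec_const hp.dist 0, rfl]
        · split_ifs
          exacts [rfl, expec_const hp.dist 0]
      · split_ifs
        exacts [rfl, expec_const hp.dist 0]
    have huwdiag : ¬ (s(u, w)).IsDiag := huw
    have hpm : expec p (inT s(u, w)) ≤ m := hp.edge _ huwdiag
    have hqpm : q * expec p (inT s(u, w)) ≤ ε := by
      rw [← hqm]; exact mul_le_mul_of_nonneg_left hpm hq0
    have hvert : ∀ a, expec p (cov r a) ≤ expec p (fun T => cov r a (G T)) := fun a =>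
      expec_mono hp.dist fun T => cov_le_cov (G1 T a)
    refine ⟨mix p G q, isDist_mix hp.dist G hq0 hq1, fun e he => ?_, fun a ha => ?_, ?_⟩
    · rw [expec_mix]
      have h1 := mul_le_mul_of_nonneg_left (hedge e) hq0
      have h2 := hp.edge e he
      by_cases h3 : e = s(u, w)
      · subst h3
        simp only [if_true, if_neg n1, if_neg n2] at h1
        have := mul_le_mul_of_nonneg_left hpm (by linarith : (0:ℝ) ≤ 1 - q)
        have h4 : (1 - q) * m = x s(u, w) := by linarith
        linarith
      · rw [if_neg h3] at h1
        have h4 : splitOff x u v w ε e = x e - ε * (if e = s(u, v) then 1 else 0)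
            - ε * (if e = s(v, w) then 1 else 0) := by simp [splitOff, h3]
        rw [h4] at h2
        split_ifs at h1 h2 with h5 h6 h6
        · exact absurd (h5.symm.trans h6) n3
        all_goals linarith
    · rw [expec_mix]
      have := mul_le_mul_of_nonneg_left (hvert a) hq0
      linarith [hp.vertex a ha]
    · rw [expec_mix, expec_mix]
      have h1 : expec p (fun T => degT v (G T)) ≤ expec p (degT v) + expec p (inT s(u, w))
          + expec p (fun T => cov r v (G T)) - expec p (cov r v) := by
        refine (expec_mono hp.dist G2).trans (le_of_eq ?_)
        rw [expec_sub, expec_add, expec_add]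
      have h2 := mul_le_mul_of_nonneg_left h1 hq0
      have h3 := hp.deg
      rw [hcut] at h3
      linarith

/-- Attaching `v` as a leaf wherever an edge at `v` has spare capacity. -/
lemma Packs.exists_saturated {r v : V} {x : Sym2 V → ℝ} {y : V → ℝ} {p : Finset (Sym2 V) → ℝ}
    (hp : Packs r v x y p) (s : Finset V) (hs : v ∉ s) :
    ∃ p', Packs r v x y p' ∧ ∀ u ∈ s, x s(u, v) ≤ expec p' (inT s(u, v)) ∨
      expec p' (fun T => cov r u T * (1 - cov r v T)) ≤ 0 := by
  induction s using Finset.induction_on with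
  | empty => exact ⟨p, hp, by simp⟩
  | insert u s hus ih =>
    rw [Finset.mem_insert, not_or] at hs
    obtain ⟨hvu, hvs⟩ := hs
    obtain ⟨p, hp, hps⟩ := ih hvs
    set act : Finset (Sym2 V) → ℝ := fun T => cov r u T * (1 - cov r v T) with hact
    have hact0 : ∀ T, 0 ≤ act T := fun T =>
      mul_nonneg (cov_nonneg _ _ _) (by linarith [cov_le_one r v T])
    set M := expec p act with hM
    rcases le_or_gt M 0 with hM0 | hM0
    · refine ⟨p, hp, fun a ha => ?_⟩
      rcases Finset.mem_insert.1 ha with rfl | ha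
      exacts [Or.inr hM0, hps a ha]
    have hdiag : ¬ (s(u, v)).IsDiag := fun h => hvu h.symm
    set sl := x s(u, v) - expec p (inT s(u, v)) with hsl
    have hsl0 : 0 ≤ sl := sub_nonneg.2 (hp.edge _ hdiag)
    set q := min 1 (sl / M) with hq
    have hq0 : 0 ≤ q := le_min zero_le_one (div_nonneg hsl0 hM0.le)
    have hq1 : q ≤ 1 := min_le_left _ _
    have hqM : q * M ≤ sl := by
      rw [← le_div_iff₀ hM0]; exact min_le_right _ _
    classical
    set G : Finset (Sym2 V) → Finset (Sym2 V) := fun T =>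
      if Reach T r u ∧ ¬ Reach T r v then insert s(u, v) T else T with hG
    have hsub : ∀ T, T ⊆ G T := by
      intro T; simp only [hG]; split_ifs
      exacts [Finset.subset_insert _ _, subset_rfl]
    have hactv : ∀ T, act T = if Reach T r u ∧ ¬ Reach T r v then 1 else 0 := by
      intro T
      simp only [hact, cov]
      by_cases h1 : Reach T r u <;> by_cases h2 : Reach T r v <;> simp [h1, h2]
    have hGv : ∀ T, Reach T r u → Reach (G T) r v := by
      intro T hT
      by_cases h : Reach T r v
      · exact h.mono (hsub T)
      · simp only [hG, hT, h, not_false_eq_true, and_self, if_true]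
        exact (hT.mono (Finset.subset_insert _ _)).trans (Reach.of_mem (Finset.mem_insert_self _ _))
    have G1 : ∀ T, inT s(u, v) (G T) = inT s(u, v) T + act T := by
      intro T
      rw [hactv]
      by_cases h : Reach T r u ∧ ¬ Reach T r v
      · have hn : s(u, v) ∉ T := fun h' => h.2 (h.1.trans (Reach.of_mem h'))
        simp only [hG, if_pos h, inT, Finset.mem_insert_self, if_true, if_neg hn]
        norm_num
      · simp only [hG, if_neg h, add_zero]
    have G2 : ∀ T e, e ≠ s(u, v) → inT e (G T) = inT e T := by
      intro T e he
      simp only [hG]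
      split_ifs
      · simp [inT, he]
      · rfl
    have G3 : ∀ T, cov r v (G T) = cov r v T + act T := by
      intro T
      rw [hactv]
      by_cases h : Reach T r u ∧ ¬ Reach T r v
      · rw [if_pos h]
        simp [cov, hGv T h.1, h.2]
      · simp only [hG, if_neg h, add_zero]
    have G4 : ∀ T, degT v (G T) ≤ degT v T + act T := by
      intro T
      rw [hactv]
      by_cases h : Reach T r u ∧ ¬ Reach T r v
      · simp only [hG, if_pos h]; exact degT_insert_le v u T
      · simp only [hG, if_neg h, add_zero, le_refl]
    have E1 : expec (mix p G q) (inT s(u, v)) = expec p (inT s(u, v)) + q * M := by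
      rw [expec_mix]; simp only [G1]; rw [expec_add, hM]; ring
    have E2 : ∀ e, e ≠ s(u, v) → expec (mix p G q) (inT e) = expec p (inT e) := by
      intro e he
      rw [expec_mix]; simp only [G2 _ e he]
      change _ + q * expec p (inT e) = _
      ring
    have E3 : expec (mix p G q) (cov r v) = expec p (cov r v) + q * M := by
      rw [expec_mix]; simp only [G3]; rw [expec_add, hM]; ring
    refine ⟨mix p G q, ⟨isDist_mix hp.dist G hq0 hq1, fun e he => ?_, fun a ha => ?_, ?_⟩,
      fun a ha => ?_⟩
    · by_cases h : e = s(u, v)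
      · subst h; rw [E1]; linarith
      · rw [E2 e h]; exact hp.edge e he
    · rw [expec_mix]
      have : expec p (cov r a) ≤ expec p (fun T => cov r a (G T)) :=
        expec_mono hp.dist fun T => cov_le_cov fun h => h.mono (hsub T)
      have := mul_le_mul_of_nonneg_left this hq0
      linarith [hp.vertex a ha]
    · rw [E3, expec_mix]
      have h1 : expec p (fun T => degT v (G T)) ≤ expec p (degT v) + M := by
        rw [hM, ← expec_add]; exact expec_mono hp.dist G4
      have := mul_le_mul_of_nonneg_left h1 hq0
      linarith [hp.deg]
    · rcases Finset.mem_insert.1 ha with rfl | ha'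
      · rcases le_total 1 (sl / M) with h | h
        · right
          have hq' : q = 1 := min_eq_left h
          rw [expec_mix, hq', sub_self, zero_mul, zero_add, one_mul]
          refine (expec_mono hp.dist (ψ := fun _ => 0) fun T => ?_).trans
            (expec_const hp.dist 0).le
          by_cases h1 : Reach T r v
          · simp [cov, h1.mono (hsub T)]
          · by_cases h2 : Reach T r a
            · simp [cov, hGv T h2]
            · have : G T = T := if_neg (by tauto)
              rw [this]; simp [cov, h2]
        · left
          have hq' : q * M = sl := by
            rw [hq, min_eq_right h]; exact div_mul_cancel₀ _ hM0.ne'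
          rw [E1, hq', hsl]; linarith
      · have hne : s(a, v) ≠ s(u, v) := by
          intro h
          rcases Sym2.eq_iff.1 h with ⟨rfl, -⟩ | ⟨rfl, -⟩
          · exact hus ha'
          · exact hvs ha'
        refine (hps a ha').imp (fun h => by rw [E2 _ hne]; exact h) fun h => ?_
        rw [expec_mix]
        have h1 : expec p (fun T => cov r a (G T) * (1 - cov r v (G T)))
            ≤ expec p (fun T => cov r a T * (1 - cov r v T)) := by
          refine expec_mono hp.dist fun T => ?_
          by_cases h : Reach T r u ∧ ¬ Reach T r v
          · have : cov r v (G T) = 1 := if_pos (hGv T h.1)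
            rw [this, sub_self, mul_zero]
            exact mul_nonneg (cov_nonneg _ _ _) (by linarith [cov_le_one r v T])
          · have : G T = T := if_neg h
            rw [this]
        have h2 := mul_le_mul_of_nonneg_left h1 hq0
        linarith

/-- Every feasible solution of the LP relaxation dominates a distribution over rooted trees. -/
theorem exists_treeDist (r : V) (x : Sym2 V → ℝ) (y : V → ℝ) (hx : ∀ e, 0 ≤ x e)
    (hy0 : ∀ u, 0 ≤ y u) (hy1 : ∀ u, y u ≤ 1) (hdeg : ∀ v, v ≠ r → cutVal x {v} = 2 * y v)
    (hcut : ∀ S : Finset V, r ∉ S → ∀ v ∈ S, 2 * y v ≤ cutVal x S) :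
    ∃ p : Finset (Sym2 V) → ℝ, IsDist p ∧ (∀ e, ¬ e.IsDiag → expec p (inT e) ≤ x e) ∧
      ∀ u, y u ≤ expec p (cov r u) := by
  obtain ⟨n, hn⟩ : ∃ n, (Finset.univ.filter fun v => v ≠ r ∧ 0 < y v).card = n := ⟨_, rfl⟩
  induction n generalizing x y with
  | zero =>
    rw [Finset.card_eq_zero, Finset.filter_eq_empty_iff] at hn
    have hE : ∀ φ : Finset (Sym2 V) → ℝ, expec (Pi.single ∅ 1) φ = φ ∅ := by
      intro φ
      simp [expec, Pi.single_apply]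
    have hd : IsDist (Pi.single ∅ 1 : Finset (Sym2 V) → ℝ) :=
      ⟨fun a => by rw [Pi.single_apply]; split_ifs <;> norm_num, by simp⟩
    refine ⟨Pi.single ∅ 1, hd, fun e _ => ?_, fun u => ?_⟩
    · rw [hE]; simpa [inT] using hx e
    · rw [hE]
      by_cases hu : u = r
      · subst hu; rw [cov_self]; exact hy1 _
      · have := hn (Finset.mem_univ u)
        push Not at this
        exact (this hu).trans (cov_nonneg _ _ _)
  | succ n ih =>
    obtain ⟨v, hv, hmin⟩ := Finset.exists_min_image
      (Finset.univ.filter fun v => v ≠ r ∧ 0 < y v) y (Finset.card_pos.1 (by omega))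
    simp only [Finset.mem_filter, Finset.mem_univ, true_and] at hv hmin
    obtain ⟨hvr, hv0⟩ := hv
    set y' := Function.update y v 0 with hy'
    have hy'v : y' v = 0 := Function.update_self ..
    have hy'u : ∀ u, u ≠ v → y' u = y u := fun u hu => Function.update_of_ne hu ..
    have hy'0 : ∀ u, 0 ≤ y' u := fun u => by
      by_cases h : u = v
      · rw [h, hy'v]
      · rw [hy'u u h]; exact hy0 u
    have hy'le : ∀ u, y' u ≤ y u := fun u => by
      by_cases h : u = v
      · rw [h, hy'v]; exact hv0.le
      · rw [hy'u u h]
    have hcard : (Finset.univ.filter fun v => v ≠ r ∧ 0 < y' v).card = n := by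
      have : (Finset.univ.filter fun v => v ≠ r ∧ 0 < y' v)
          = (Finset.univ.filter fun v => v ≠ r ∧ 0 < y v).erase v := by
        ext a
        by_cases h : a = v
        · subst h; simp [hy'v]
        · simp [h, hy'u]
      rw [this, Finset.card_erase_of_mem (by simp [hvr, hv0])]
      omega
    have hcov : Covers (req r y') x := covers_req_iff.2
      ⟨hx, fun S hS u hu => by linarith [hcut S hS u hu, hy'le u]⟩
    obtain ⟨p, hp⟩ : ∃ p, Packs r v x y p := by
      refine splitOff_induction (isProper_req r y') v (fun z =>
        (∀ u, u ≠ r → u ≠ v → cutVal z {u} ≤ 2 * y u) → ∃ p, Packs r v z y p) ?_ ?_ x hcov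
        (fun u hu _ => (hdeg u hu).le)
      · intro z hz hzv hzu
        have hz' := covers_req_iff.1 hz
        have hzv0 : cutVal z {v} ≤ 0 := by
          refine hzv.trans (max_le le_rfl ?_)
          rw [req_le_iff (by simpa using hvr.symm) le_rfl]
          simp [hy'v]
        have hzv' : cutVal z {v} = 0 := le_antisymm hzv0 (cutVal_nonneg hz.nonneg _)
        obtain ⟨p, h1, h2, h3⟩ := ih z y' hz.nonneg hy'0 (fun u => (hy'le u).trans (hy1 u))
          (fun u hu => by
            by_cases h : u = v
            · rw [h, hy'v, hzv', mul_zero]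
            · refine le_antisymm ?_ (hz'.2 {u} (by simpa using hu.symm) u (by simp))
              rw [hy'u u h]; exact hzu u hu h) hz'.2 hcard
        refine ⟨p, h1, h2, fun u hu => (hy'u u hu) ▸ h3 u, ?_⟩
        have h4 : 0 ≤ expec p (cov r v) := by
          have := h3 v; rwa [hy'v] at this
        have h5 : expec p (degT v) ≤ 0 := by
          rw [expec_degT, ← hzv', cutVal_singleton]
          exact Finset.sum_le_sum fun a ha => h2 _ (Finset.ne_of_mem_erase ha)
        linarith
      · intro z u w ε hz hε hu hw _ hgood hzu
        obtain ⟨p, hp⟩ := hgood fun a h1 h2 =>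
          (cutVal_splitOff_le z u v w hε {a}).trans (hzu a h1 h2)
        exact hp.unsplit hε hu hw hz.nonneg
    obtain ⟨p, hp, hsat⟩ := hp.exists_saturated (Finset.univ.erase v) (by simp)
    refine ⟨p, hp.dist, hp.edge, fun u => ?_⟩
    by_cases huv : u = v
    swap
    · exact hp.vertex u huv
    subst huv
    by_contra! hlt
    have hd := hp.deg
    rw [hdeg u hvr, expec_degT] at hd
    obtain ⟨a, ha, hax⟩ : ∃ a ∈ Finset.univ.erase u, expec p (inT s(a, u)) < x s(a, u) := by
      by_contra! hcon
      have := Finset.sum_le_sum hcon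
      rw [← cutVal_singleton, hdeg u hvr] at this
      linarith
    have hau := Finset.ne_of_mem_erase ha
    have hM := (hsat a ha).resolve_left (not_le.2 hax)
    have h1 : expec p (cov r a) ≤ expec p (cov r u) := by
      have : expec p (cov r a) ≤ expec p (fun T => cov r u T + cov r a T * (1 - cov r u T)) := by
        refine expec_mono hp.dist fun T => ?_
        nlinarith [cov_nonneg r u T, cov_nonneg r a T, cov_le_one r u T, cov_le_one r a T]
      rw [expec_add] at this
      linarith
    have hxa : 0 < x s(a, u) := by
      refine lt_of_le_of_lt ?_ hax
      exact Finset.sum_nonneg fun T _ => mul_nonneg (hp.dist.nonneg T) (inT_nonneg _ _)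
    have h2 := hp.vertex a hau
    have h3 : y u ≤ y a := by
      by_cases har : a = r
      · rw [har]
        have h4 : (1:ℝ) = expec p (cov r r) := by
          rw [show cov r r = fun _ : Finset (Sym2 V) => (1:ℝ) from funext (cov_self r)]
          exact (expec_const hp.dist 1).symm
        rw [har] at h1
        linarith [hy1 u]
      · refine hmin a ⟨har, ?_⟩
        have h4 : x s(a, u) ≤ cutVal x {a} := by
          rw [cutVal_singleton, Sym2.eq_swap]
          exact Finset.single_le_sum (f := fun b => x s(b, a)) (fun b _ => hx _)
            (Finset.mem_erase.2 ⟨hau.symm, Finset.mem_univ u⟩)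
        rw [hdeg a har] at h4
        linarith
    linarith

end TreeDistributions

section Matching

variable {V : Type*} [Fintype V] [DecidableEq V]

/-- `m` restricts to a fixed-point free involution of `B`. -/
def IsPM (B : Finset V) (m : V → V) : Prop := ∀ v ∈ B, m v ∈ B ∧ m v ≠ v ∧ m (m v) = v

/-- Twice the cost of the perfect matching `m` of `B`. -/
def pmCost (c : V → V → ℝ) (B : Finset V) (m : V → V) : ℝ := ∑ v ∈ B, c v (m v)

/-- The weight of the edges between `S` and the rest of `A`. -/
def cutIn (A : Finset V) (z : V → V → ℝ) (S : Finset V) : ℝ := ∑ u ∈ S, ∑ w ∈ A \ S, z u w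

/-- Points of the perfect matching polytope of the complete graph on `A`. -/
structure FracPM (A : Finset V) (z : V → V → ℝ) : Prop where
  nonneg : ∀ u w, 0 ≤ z u w
  symm : ∀ u w, z u w = z w u
  diag : ∀ u, z u u = 0
  deg : ∀ u ∈ A, ∑ w ∈ A, z u w = 1
  cut : ∀ S ⊆ A, Odd S.card → 1 ≤ cutIn A z S

lemma FracPM.even {A : Finset V} {z : V → V → ℝ} (h : FracPM A z) : Even A.card := by
  by_contra ho
  have := h.cut A subset_rfl (Nat.not_even_iff_odd.1 ho)
  simp [cutIn] at this
  linarith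

lemma cutIn_sdiff {A : Finset V} {z : V → V → ℝ} (hs : ∀ u w, z u w = z w u) {S : Finset V}
    (hS : S ⊆ A) : cutIn A z (A \ S) = cutIn A z S := by
  unfold cutIn
  rw [Finset.sdiff_sdiff_eq_self hS, Finset.sum_comm]
  simp only [hs]

lemma cutIn_singleton {A : Finset V} {z : V → V → ℝ} (hd : ∀ u, z u u = 0) {v : V} (hv : v ∈ A) :
    cutIn A z {v} = ∑ w ∈ A, z v w := by
  simp [cutIn, ← Finset.erase_eq, ← Finset.add_sum_erase A _ hv, hd]

lemma IsPM.union {B C : Finset V} {m n : V → V} (hm : IsPM B m) (hn : IsPM C n)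
    (hBC : Disjoint B C) (c : V → V → ℝ) :
    ∃ k, IsPM (B ∪ C) k ∧ pmCost c (B ∪ C) k = pmCost c B m + pmCost c C n := by
  have hC : ∀ v ∈ C, v ∉ B := fun v h h' => Finset.disjoint_left.1 hBC h' h
  refine ⟨fun v => if v ∈ B then m v else n v, fun v hv => ?_, ?_⟩
  · by_cases h : v ∈ B
    · have := hm v h
      simp [h, this]
    · have hv' : v ∈ C := by simpa [h] using hv
      have := hn v hv'
      simp [h, this, hC _ this.1]
  · unfold pmCost
    rw [Finset.sum_union hBC]
    congr 1
    · exact Finset.sum_congr rfl fun v hv => by simp [hv]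
    · exact Finset.sum_congr rfl fun v hv => by simp [hC v hv]

lemma exists_isPM_pair {a b : V} (h : a ≠ b) (c : V → V → ℝ) :
    ∃ m, IsPM {a, b} m ∧ pmCost c {a, b} m = c a b + c b a := by
  refine ⟨Equiv.swap a b, fun v hv => ?_, ?_⟩
  · simp only [Finset.mem_insert, Finset.mem_singleton] at hv
    rcases hv with rfl | rfl <;> simp [h, h.symm]
  · simp [pmCost, Finset.sum_pair h]

lemma exists_isPM (B : Finset V) (hB : Even B.card) : ∃ m, IsPM B m := by
  induction B using Finset.strongInduction with
  | H B ih =>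
    rcases B.eq_empty_or_nonempty with rfl | ⟨a, ha⟩
    · exact ⟨id, by simp [IsPM]⟩
    · have h1 : (B.erase a).card + 1 = B.card := Finset.card_erase_add_one ha
      obtain ⟨b, hb⟩ : (B.erase a).Nonempty := by
        rw [← Finset.card_pos]
        by_contra h
        rw [← h1, show (B.erase a).card = 0 by omega] at hB
        simp at hB
      have h2 : ((B.erase a).erase b).card + 1 = (B.erase a).card := Finset.card_erase_add_one hb
      have hab : a ≠ b := fun h => by simp [h] at hb
      obtain ⟨m, hm⟩ := ih ((B.erase a).erase b)
        ((Finset.erase_subset _ _).trans_ssubset (Finset.erase_ssubset ha))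
        (by rw [← h1, ← h2] at hB; simpa [Nat.even_add_one] using hB)
      obtain ⟨n, hn, -⟩ := exists_isPM_pair hab fun _ _ => 0
      obtain ⟨k, hk, -⟩ := hn.union hm (by
        rw [Finset.disjoint_left]; intro x hx; simp at hx ⊢; tauto) fun _ _ => 0
      have : {a, b} ∪ (B.erase a).erase b = B := by
        have hb' := Finset.mem_of_mem_erase hb
        ext x; simp only [Finset.mem_union, Finset.mem_insert, Finset.mem_singleton,
          Finset.mem_erase]
        by_cases hxa : x = a
        · subst hxa; simpa using ha
        · by_cases hxb : x = b
          · subst hxb; simpa using hb'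
          · simp [hxa, hxb]
      exact ⟨k, this ▸ hk⟩

lemma exists_min_isPM (c : V → V → ℝ) (B : Finset V) (hB : Even B.card) :
    ∃ m, IsPM B m ∧ ∀ n, IsPM B n → pmCost c B m ≤ pmCost c B n := by
  classical
  obtain ⟨m, hm⟩ := exists_isPM B hB
  obtain ⟨k, hk, hmin⟩ := Finset.exists_min_image (Finset.univ.filter fun n => IsPM B n)
    (pmCost c B) ⟨m, by simpa using hm⟩
  exact ⟨k, by simpa using hk, fun n hn => hmin n (by simpa using hn)⟩

/-- Weights after contracting `S` to `s`. -/
def contract (z : V → V → ℝ) (S : Finset V) (s u w : V) : ℝ :=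
  if u = s then if w = s then 0 else ∑ p ∈ S, z p w
  else if w = s then ∑ p ∈ S, z u p else z u w

lemma FracPM.contract {A : Finset V} {z : V → V → ℝ} (hz : FracPM A z) {S : Finset V}
    (hS : S ⊆ A) (ho : Odd S.card) (ht : cutIn A z S = 1) {s : V} (hs : s ∈ S) :
    FracPM (insert s (A \ S)) (contract z S s) := by
  have hsT : s ∉ A \ S := by simp [hs]
  have hne : ∀ w ∈ A \ S, w ≠ s := fun w hw h => hsT (h ▸ hw)
  have hsplit : ∀ u, ∑ w ∈ A, z u w = ∑ p ∈ S, z u p + ∑ w ∈ A \ S, z u w := fun u => by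
    rw [add_comm, Finset.sum_sdiff hS]
  refine ⟨fun u w => ?_, fun u w => ?_, fun u => ?_, fun u hu => ?_, fun X hX hXo => ?_⟩
  · unfold PCTSP.contract
    split_ifs
    · rfl
    · exact Finset.sum_nonneg fun _ _ => hz.nonneg _ _
    · exact Finset.sum_nonneg fun _ _ => hz.nonneg _ _
    · exact hz.nonneg _ _
  · unfold PCTSP.contract
    split_ifs
    · rfl
    · exact Finset.sum_congr rfl fun _ _ => hz.symm _ _
    · exact Finset.sum_congr rfl fun _ _ => hz.symm _ _
    · exact hz.symm _ _
  · unfold PCTSP.contract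
    split_ifs
    · rfl
    · exact hz.diag u
  · rw [Finset.sum_insert hsT]
    rcases Finset.mem_insert.1 hu with rfl | hu'
    · rw [← ht, cutIn, Finset.sum_comm]
      simp only [PCTSP.contract, if_true, zero_add]
      exact Finset.sum_congr rfl fun w hw => by rw [if_neg (hne w hw)]
    · rw [← hz.deg u (Finset.mem_sdiff.1 hu').1, hsplit]
      simp only [PCTSP.contract, if_neg (hne u hu'), if_true]
      congr 1
      exact Finset.sum_congr rfl fun w hw => by rw [if_neg (hne w hw)]
  · by_cases hsX : s ∈ X
    · have h1 : insert s (A \ S) \ X = (A \ S) \ X := by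
        rw [Finset.insert_sdiff_of_mem _ hsX]
      have hd : Disjoint (X.erase s) S := by
        rw [Finset.disjoint_left]
        intro x hx
        have := hX (Finset.mem_of_mem_erase hx)
        simp at this hx; tauto
      have hsub : X.erase s ∪ S ⊆ A := by
        refine Finset.union_subset (fun x hx => ?_) hS
        have := hX (Finset.mem_of_mem_erase hx)
        simp at this hx; tauto
      have hA : A \ (X.erase s ∪ S) = (A \ S) \ X := by
        ext x; simp only [Finset.mem_sdiff, Finset.mem_union, Finset.mem_erase]
        by_cases h : x = s
        · subst h; simp [hs]
        · tauto
      have hcard : Odd (X.erase s ∪ S).card := by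
        rw [Finset.card_union_of_disjoint hd]
        rw [← Finset.card_erase_add_one hsX] at hXo
        rw [Nat.odd_add]
        simp only [Nat.not_even_iff_odd.2 ho]
        rw [Nat.odd_add_one] at hXo
        simpa using hXo
      refine (hz.cut _ hsub hcard).trans_eq ?_
      unfold cutIn
      rw [hA, h1, Finset.sum_union hd, ← Finset.add_sum_erase _ _ hsX, add_comm]
      congr 1
      · rw [Finset.sum_comm]
        refine Finset.sum_congr rfl fun w hw => ?_
        simp [PCTSP.contract, hne w (Finset.mem_sdiff.1 hw).1]
      · refine Finset.sum_congr rfl fun u hu => Finset.sum_congr rfl fun w hw => ?_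
        simp [PCTSP.contract, hne w (Finset.mem_sdiff.1 hw).1, Finset.ne_of_mem_erase hu]
    · have hXT : X ⊆ A \ S := fun x hx => by
        have := hX hx
        rw [Finset.mem_insert] at this
        exact this.resolve_left fun h => hsX (h ▸ hx)
      have h1 : insert s (A \ S) \ X = insert s ((A \ S) \ X) := by
        rw [Finset.insert_sdiff_of_notMem _ hsX]
      refine (hz.cut X (hXT.trans Finset.sdiff_subset) hXo).trans_eq ?_
      unfold cutIn
      refine Finset.sum_congr rfl fun u hu => ?_
      have hd : Disjoint S ((A \ S) \ X) := by
        rw [Finset.disjoint_left]; intro x hx; simp [hx]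
      have hA : A \ X = S ∪ ((A \ S) \ X) := by
        ext x; simp only [Finset.mem_sdiff, Finset.mem_union]
        have := @hXT x; have := @hS x
        simp only [Finset.mem_sdiff] at *
        tauto
      rw [h1, hA, Finset.sum_union hd, Finset.sum_insert (by simp [hs])]
      congr 1
      · simp [PCTSP.contract, hne u (hXT hu)]
      · refine Finset.sum_congr rfl fun w hw => ?_
        simp [PCTSP.contract, hne w (Finset.mem_sdiff.1 hw).1, hne u (hXT hu)]

/-- The perfect matching polytope of the complete graph on `A` is integral. -/
def Integral (A : Finset V) : Prop :=
  ∀ z, FracPM A z → ∀ c : V → V → ℝ, (∀ u w, c u w = c w u) →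
    ∃ m, IsPM A m ∧ pmCost c A m ≤ ∑ u ∈ A, ∑ w ∈ A, z u w * c u w

lemma FracPM.sum_le_of_contract {A : Finset V} {z : V → V → ℝ} (hz : FracPM A z) {S : Finset V}
    (hS : S ⊆ A) (ho : Odd S.card) (ht : cutIn A z S = 1) {s : V} (hs : s ∈ S)
    (hI : Integral (insert s (A \ S))) (c : V → V → ℝ) (hc : ∀ u w, c u w = c w u) (K : V → ℝ)
    (hK : ∀ a ∈ A \ S, ∀ m, IsPM ((A \ S).erase a) m → K a ≤ pmCost c ((A \ S).erase a) m) :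
    ∑ w ∈ A \ S, (∑ p ∈ S, z p w) * K w ≤ ∑ u ∈ A \ S, ∑ w ∈ A \ S, z u w * c u w := by
  have hsT : s ∉ A \ S := by simp [hs]
  have hne : ∀ w ∈ A \ S, w ≠ s := fun w hw h => hsT (h ▸ hw)
  set T := A \ S with hT
  let c' : V → V → ℝ := fun u w =>
    if u = s then -(K w / 2) else if w = s then -(K u / 2) else c u w
  obtain ⟨m, hm, hle⟩ := hI _ (hz.contract hS ho ht hs) c' fun u w => by
    simp only [c']
    split_ifs with h1 h2
    · rw [h1, h2]
    · rfl
    · rfl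
    · exact hc u w
  have hms := hm s (Finset.mem_insert_self _ _)
  have hmT : m s ∈ T := (Finset.mem_insert.1 hms.1).resolve_left hms.2.1
  have hpm : IsPM (T.erase (m s)) m := by
    intro v hv
    obtain ⟨hv1, hv2⟩ := Finset.mem_erase.1 hv
    obtain ⟨h1, h2, h3⟩ := hm v (Finset.mem_insert_of_mem hv2)
    refine ⟨Finset.mem_erase.2 ⟨fun h => hne v hv2 ?_, (Finset.mem_insert.1 h1).resolve_left
      fun h => hv1 ?_⟩, h2, h3⟩
    · rw [← h3, h, hms.2.2]
    · rw [← h3, h]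
  have h0 : 0 ≤ pmCost c' (insert s T) m := by
    unfold pmCost
    rw [Finset.sum_insert hsT, ← Finset.add_sum_erase _ _ hmT]
    have h1 := hK _ hmT m hpm
    have h2 : ∑ v ∈ T.erase (m s), c' v (m v) = pmCost c (T.erase (m s)) m := by
      refine Finset.sum_congr rfl fun v hv => ?_
      have := hne _ (Finset.mem_of_mem_erase (hpm v hv).1)
      simp [c', hne _ (Finset.mem_of_mem_erase hv), this]
    have h3 : c' s (m s) = -(K (m s) / 2) := by simp [c']
    have h4 : c' (m s) (m (m s)) = -(K (m s) / 2) := by simp [c', hms.2.1, hms.2.2]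
    rw [h2, h3, h4]; linarith
  have h1 := h0.trans hle
  have h2 : ∑ w ∈ T, PCTSP.contract z S s s w * c' s w
      = ∑ w ∈ T, -((∑ p ∈ S, z p w) * K w / 2) := by
    refine Finset.sum_congr rfl fun w hw => ?_
    simp only [PCTSP.contract, c', if_true, if_neg (hne w hw)]; ring
  have h3 : ∑ u ∈ T, ∑ w ∈ insert s T, PCTSP.contract z S s u w * c' u w
      = ∑ w ∈ T, -((∑ p ∈ S, z p w) * K w / 2) + ∑ u ∈ T, ∑ w ∈ T, z u w * c u w := by
    rw [← Finset.sum_add_distrib]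
    refine Finset.sum_congr rfl fun u hu => ?_
    rw [Finset.sum_insert hsT]
    congr 1
    · simp only [PCTSP.contract, c', if_true, if_neg (hne u hu), hz.symm u]; ring
    · refine Finset.sum_congr rfl fun w hw => ?_
      simp only [PCTSP.contract, c', if_neg (hne u hu), if_neg (hne w hw)]
  rw [Finset.sum_insert hsT, h3, Finset.sum_insert hsT, h2] at h1
  simp only [PCTSP.contract, if_true, zero_mul, zero_add, Finset.sum_neg_distrib,
    ← Finset.sum_div] at h1
  linarith

/-- Gluing matchings of the two contractions along a tight odd cut. -/
lemma FracPM.glue {A : Finset V} {z : V → V → ℝ} (hz : FracPM A z) {S : Finset V}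
    (hS : S ⊆ A) (ho : Odd S.card) (h1 : 1 < S.card) (h2 : 1 < (A \ S).card)
    (ht : cutIn A z S = 1) (hI : ∀ B : Finset V, B.card < A.card → Integral B)
    (c : V → V → ℝ) (hc : ∀ u w, c u w = c w u) :
    ∃ m, IsPM A m ∧ pmCost c A m ≤ ∑ u ∈ A, ∑ w ∈ A, z u w * c u w := by
  have hcard : (A \ S).card + S.card = A.card := Finset.card_sdiff_add_card_eq_card hS
  have hoT : Odd (A \ S).card := by
    have := hz.even
    rw [← hcard, Nat.even_add] at this
    rw [← Nat.not_even_iff_odd] at ho ⊢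
    tauto
  have hTT : A \ (A \ S) = S := Finset.sdiff_sdiff_eq_self hS
  have ht' : cutIn A z (A \ S) = 1 := by rw [cutIn_sdiff hz.symm hS, ht]
  obtain ⟨s, hs⟩ := Finset.card_pos.1 (zero_lt_one.trans h1)
  obtain ⟨t, htT⟩ := Finset.card_pos.1 (zero_lt_one.trans h2)
  have key : ∀ T : Finset V, Odd T.card → ∃ f : V → V → V, ∀ a ∈ T, IsPM (T.erase a) (f a) ∧
      ∀ m, IsPM (T.erase a) m → pmCost c (T.erase a) (f a) ≤ pmCost c (T.erase a) m := by
    intro T hT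
    have : ∀ a, ∃ m, a ∈ T → IsPM (T.erase a) m ∧
        ∀ n, IsPM (T.erase a) n → pmCost c (T.erase a) m ≤ pmCost c (T.erase a) n := by
      intro a
      by_cases ha : a ∈ T
      · obtain ⟨m, hm⟩ := exists_min_isPM c (T.erase a) (by
          rw [← Finset.card_erase_add_one ha, Nat.odd_add_one] at hT
          simpa using hT)
        exact ⟨m, fun _ => hm⟩
      · exact ⟨id, fun h => absurd h ha⟩
    choose f hf using this
    exact ⟨f, hf⟩
  obtain ⟨f, hf⟩ := key S ho
  obtain ⟨g, hg⟩ := key (A \ S) hoT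
  have e1 := hz.sum_le_of_contract hS ho ht hs (hI _ (by
    rw [Finset.card_insert_of_notMem (by simp [hs])]; omega)) c hc
    (fun a => pmCost c ((A \ S).erase a) (g a)) fun a ha => (hg a ha).2
  have e2 := hz.sum_le_of_contract Finset.sdiff_subset hoT ht' htT (hI _ (by
    rw [hTT, Finset.card_insert_of_notMem (by simp at htT; tauto)]; omega)) c hc
    (fun a => pmCost c (S.erase a) (f a)) fun a ha => by rw [hTT] at ha ⊢; exact (hf a ha).2
  rw [hTT] at e2
  set T := A \ S with hT
  set Kg : V → ℝ := fun a => pmCost c (T.erase a) (g a)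
  set Kf : V → ℝ := fun a => pmCost c (S.erase a) (f a)
  have hsum : ∑ u ∈ A, ∑ w ∈ A, z u w * c u w = ∑ u ∈ T, ∑ w ∈ T, z u w * c u w
      + ∑ u ∈ S, ∑ w ∈ S, z u w * c u w + 2 * ∑ u ∈ S, ∑ w ∈ T, z u w * c u w := by
    have : ∀ φ : V → ℝ, ∑ u ∈ A, φ u = ∑ u ∈ T, φ u + ∑ u ∈ S, φ u := fun φ =>
      (Finset.sum_sdiff hS).symm
    simp only [this, Finset.sum_add_distrib]
    rw [Finset.sum_comm (s := T) (t := S)]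
    have : ∑ u ∈ S, ∑ w ∈ T, z w u * c w u = ∑ u ∈ S, ∑ w ∈ T, z u w * c u w :=
      Finset.sum_congr rfl fun u _ => Finset.sum_congr rfl fun w _ => by
        rw [hz.symm w u, hc w u]
    linarith
  have hav : ∃ b ∈ S, ∃ a ∈ T, Kg a + Kf b + 2 * c b a
      ≤ ∑ u ∈ A, ∑ w ∈ A, z u w * c u w := by
    by_contra! hcon
    set Q := ∑ u ∈ A, ∑ w ∈ A, z u w * c u w
    have l1 : ∑ b ∈ S, ∑ a ∈ T, z b a * (Kg a + Kf b + 2 * c b a) ≤ Q := by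
      have f1 : ∑ b ∈ S, ∑ a ∈ T, z b a * Kg a = ∑ w ∈ T, (∑ p ∈ S, z p w) * Kg w := by
        rw [Finset.sum_comm]; simp only [Finset.sum_mul]
      have f2 : ∑ b ∈ S, ∑ a ∈ T, z b a * Kf b = ∑ w ∈ S, (∑ p ∈ T, z p w) * Kf w := by
        simp only [Finset.sum_mul]
        exact Finset.sum_congr rfl fun u _ => Finset.sum_congr rfl fun w _ => by
          rw [hz.symm w u]
      have f3 : ∑ b ∈ S, ∑ a ∈ T, z b a * (2 * c b a)
          = 2 * ∑ b ∈ S, ∑ a ∈ T, z b a * c b a := by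
        simp only [Finset.mul_sum]
        exact Finset.sum_congr rfl fun u _ => Finset.sum_congr rfl fun w _ => by ring
      simp only [mul_add, Finset.sum_add_distrib]
      linarith
    have l2 : ∑ b ∈ S, ∑ a ∈ T, z b a * Q = Q := by
      simp only [← Finset.sum_mul]
      have : ∑ b ∈ S, ∑ a ∈ T, z b a = 1 := ht
      rw [this, one_mul]
    have l3 : ∀ b ∈ S, ∀ a ∈ T, 0 ≤ z b a * (Kg a + Kf b + 2 * c b a - Q) := fun b hb a ha =>
      mul_nonneg (hz.nonneg _ _) (by linarith [hcon b hb a ha])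
    have l4 : ∑ b ∈ S, ∑ a ∈ T, z b a * (Kg a + Kf b + 2 * c b a - Q) ≤ 0 := by
      simp only [mul_sub, Finset.sum_sub_distrib]; linarith
    have l5 : ∀ b ∈ S, ∀ a ∈ T, z b a = 0 := by
      intro b hb a ha
      have m1 := (Finset.sum_eq_zero_iff_of_nonneg fun b hb => Finset.sum_nonneg (l3 b hb)).1
        (le_antisymm l4 (Finset.sum_nonneg fun b hb => Finset.sum_nonneg (l3 b hb))) b hb
      have m2 := (Finset.sum_eq_zero_iff_of_nonneg (l3 b hb)).1 m1 a ha
      exact (mul_eq_zero.1 m2).resolve_right (by linarith [hcon b hb a ha])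
    have : cutIn A z S = 0 :=
      Finset.sum_eq_zero fun b hb => Finset.sum_eq_zero fun a ha => l5 b hb a ha
    linarith
  obtain ⟨b, hb, a, ha, hle⟩ := hav
  have hST : ∀ x, x ∈ S → x ∈ T → False := fun x h h' => (Finset.mem_sdiff.1 h').2 h
  obtain ⟨k, hk, hkc⟩ := (hf b hb).1.union (hg a ha).1 (Finset.disjoint_left.2 fun x h h' =>
    hST x (Finset.mem_of_mem_erase h) (Finset.mem_of_mem_erase h')) c
  have hba : b ≠ a := fun h => hST b hb (h ▸ ha)
  obtain ⟨n, hn, hnc⟩ := exists_isPM_pair hba c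
  obtain ⟨l, hl, hlc⟩ := hn.union hk (Finset.disjoint_left.2 fun x h h' => by
    simp only [Finset.mem_insert, Finset.mem_singleton] at h
    simp only [Finset.mem_union, Finset.mem_erase] at h'
    rcases h with rfl | rfl
    · exact h'.elim (fun h => h.1 rfl) fun h => hST _ hb h.2
    · exact h'.elim (fun h => hST _ h.2 ha) fun h => h.1 rfl) c
  have hA : {b, a} ∪ (S.erase b ∪ T.erase a) = A := by
    ext x
    simp only [Finset.mem_union, Finset.mem_insert, Finset.mem_singleton, Finset.mem_erase]
    have : x ∈ A ↔ x ∈ S ∨ x ∈ T := by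
      rw [hT, Finset.mem_sdiff]; have := @hS x; tauto
    rw [this]
    by_cases hx : x = b
    · subst hx; simp [hb]
    · by_cases hx' : x = a
      · subst hx'; simp [ha]
      · simp [hx, hx']
  rw [hA] at hl hlc
  refine ⟨l, hl, ?_⟩
  rw [hlc, hkc, hnc, hc a b]
  simp only [Kg, Kf] at hle
  linarith

/-- The support of a point of the perfect matching polytope contains a perfect matching. -/
lemma FracPM.exists_isPM {A : Finset V} {z : V → V → ℝ} (hz : FracPM A z) :
    ∃ m, IsPM A m ∧ ∀ v ∈ A, 0 < z v (m v) := by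
  classical
  let G : SimpleGraph A :=
    { Adj := fun u w => u ≠ w ∧ 0 < z u w
      symm := ⟨fun u w h => ⟨Ne.symm h.1, by rw [hz.symm]; exact h.2⟩⟩
      loopless := ⟨fun u h => h.1 rfl⟩ }
  have hT : ∃ M : G.Subgraph, M.IsPerfectMatching := by
    rw [SimpleGraph.tutte]
    intro U hU
    unfold SimpleGraph.IsTutteViolator at hU
    set H := ((⊤ : G.Subgraph).deleteVerts U) with hH
    let ι : H.verts → V := fun v => v.1.1
    have hι : Function.Injective ι := fun a b h => Subtype.ext (Subtype.ext h)
    let UF : Finset V := U.toFinset.image Subtype.val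
    have hUF : UF.card = U.ncard := by
      rw [Finset.card_image_of_injective _ Subtype.val_injective, Set.ncard_eq_toFinset_card']
    have hUFA : UF ⊆ A := fun w hw => by
      obtain ⟨a, -, rfl⟩ := Finset.mem_image.1 hw
      exact a.2
    let fib : H.coe.ConnectedComponent → Finset H.verts := fun C =>
      Finset.univ.filter fun v => H.coe.connectedComponentMk v = C
    have hodd : ∀ C ∈ H.coe.oddComponents.toFinset,
        1 ≤ ∑ v ∈ fib C, ∑ w ∈ UF, z (ι v) w := by
      intro C hC
      have hC' : Odd C.supp.ncard := by simpa using hC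
      have hcard : C.supp.ncard = ((fib C).image ι).card := by
        rw [Finset.card_image_of_injective _ hι, Set.ncard_eq_toFinset_card']
        congr 1
        ext v
        simp [fib]
      rw [hcard] at hC'
      refine (hz.cut _ (fun u hu => ?_) hC').trans ?_
      · obtain ⟨v, -, rfl⟩ := Finset.mem_image.1 hu
        exact v.1.2
      · unfold cutIn
        rw [Finset.sum_image fun a _ b _ h => hι h]
        refine Finset.sum_le_sum fun v hv => ?_
        rw [← Finset.sum_filter_ne_zero]
        refine Finset.sum_le_sum_of_subset_of_nonneg (fun w hw => ?_) fun w _ _ => hz.nonneg _ _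
        obtain ⟨hw, hne⟩ := Finset.mem_filter.1 hw
        by_contra hwU
        obtain ⟨hwA, hwS⟩ := Finset.mem_sdiff.1 hw
        have hwU' : (⟨w, hwA⟩ : A) ∉ U := fun h => hwU (Finset.mem_image.2 ⟨⟨w, hwA⟩, by simpa using h, rfl⟩)
        have hwH : (⟨w, hwA⟩ : A) ∈ H.verts := by simp [hH, hwU']
        apply hwS
        refine Finset.mem_image.2 ⟨⟨⟨w, hwA⟩, hwH⟩, ?_, rfl⟩
        have hpos : 0 < z (ι v) w := lt_of_le_of_ne (hz.nonneg _ _) hne.symm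
        have hadj : H.coe.Adj v ⟨⟨w, hwA⟩, hwH⟩ := by
          have hv := v.2
          simp only [hH, SimpleGraph.Subgraph.coe_adj, SimpleGraph.Subgraph.deleteVerts_adj,
            SimpleGraph.Subgraph.top_adj, SimpleGraph.Subgraph.verts_top, Set.mem_univ, true_and]
          refine ⟨by simpa [hH] using hv, hwU', fun h => ?_, hpos⟩
          rw [show ι v = w from congrArg Subtype.val h, hz.diag] at hpos
          exact lt_irrefl _ hpos
        simp only [fib, Finset.mem_filter, Finset.mem_univ, true_and] at hv ⊢
        rw [← hv]
        exact (SimpleGraph.ConnectedComponent.connectedComponentMk_eq_of_adj hadj).symm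
    have h1 : (H.coe.oddComponents.ncard : ℝ) ≤ ∑ v : H.verts, ∑ w ∈ UF, z (ι v) w := by
      rw [Set.ncard_eq_toFinset_card', Finset.card_eq_sum_ones, Nat.cast_sum]
      simp only [Nat.cast_one]
      refine (Finset.sum_le_sum hodd).trans ?_
      rw [← Finset.sum_fiberwise Finset.univ fun v => H.coe.connectedComponentMk v]
      exact Finset.sum_le_sum_of_subset_of_nonneg (Finset.subset_univ _) fun C _ _ =>
        Finset.sum_nonneg fun v _ => Finset.sum_nonneg fun w _ => hz.nonneg _ _
    have h2 : ∑ v : H.verts, ∑ w ∈ UF, z (ι v) w ≤ ∑ u ∈ A, ∑ w ∈ UF, z u w := by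
      rw [← Finset.sum_image (f := fun u => ∑ w ∈ UF, z u w) (s := Finset.univ) (g := ι) fun a _ b _ h => hι h]
      refine Finset.sum_le_sum_of_subset_of_nonneg (fun u hu => ?_) fun C _ _ =>
        Finset.sum_nonneg fun w _ => hz.nonneg _ _
      obtain ⟨v, -, rfl⟩ := Finset.mem_image.1 hu
      exact v.1.2
    have h3 : ∑ u ∈ A, ∑ w ∈ UF, z u w = UF.card := by
      rw [Finset.sum_comm, Finset.card_eq_sum_ones, Nat.cast_sum]
      refine Finset.sum_congr rfl fun w hw => ?_
      rw [Nat.cast_one, ← hz.deg w (hUFA hw)]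
      exact Finset.sum_congr rfl fun u _ => hz.symm _ _
    have h4 : (H.coe.oddComponents.ncard : ℝ) ≤ UF.card := h1.trans (h2.trans_eq h3)
    rw [hUF] at h4
    exact absurd hU (not_lt.2 (by exact_mod_cast h4))
  obtain ⟨M, hM⟩ := hT
  have hM' := SimpleGraph.Subgraph.isPerfectMatching_iff.1 hM
  choose f hf hf' using hM'
  refine ⟨fun v => if h : v ∈ A then f ⟨v, h⟩ else v, fun v hv => ?_, fun v hv => ?_⟩
  · have h1 : f (f ⟨v, hv⟩) = ⟨v, hv⟩ := (hf' _ _ (hf ⟨v, hv⟩).symm).symm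
    have h2 := (hf ⟨v, hv⟩).adj_sub.1
    have h3 : (f ⟨v, hv⟩ : V) ∈ A := (f ⟨v, hv⟩).2
    have h4 : (f ⟨v, hv⟩ : V) ≠ v := fun h => h2 (Subtype.ext h.symm)
    simp [hv, h1, h4]
  · have h2 := (hf ⟨v, hv⟩).adj_sub.2
    simpa [hv] using h2

/-- Edmonds' perfect matching polytope theorem for complete graphs. -/
theorem integral (A : Finset V) : Integral A := by
  obtain ⟨n, hn⟩ : ∃ n, A.card = n := ⟨_, rfl⟩
  induction n using Nat.strong_induction_on generalizing A with
  | _ n ihA =>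
  have hI : ∀ B : Finset V, B.card < A.card → Integral B := fun B hB =>
    ihA _ (hn ▸ hB) B rfl
  intro z hz c hc
  obtain ⟨k, hk⟩ : ∃ k, (Finset.univ.filter fun p : V × V => z p.1 p.2 ≠ 0).card = k := ⟨_, rfl⟩
  induction k using Nat.strong_induction_on generalizing z with
  | _ k ih =>
  obtain ⟨M, hM, hpos⟩ := hz.exists_isPM
  by_cases hcost : pmCost c A M ≤ ∑ u ∈ A, ∑ w ∈ A, z u w * c u w
  · exact ⟨M, hM, hcost⟩
  push Not at hcost
  let e : V → V → ℝ := fun u w => if u ∈ A ∧ w = M u then 1 else 0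
  have hes : ∀ u w, e u w = e w u := fun u w => by
    have : (u ∈ A ∧ w = M u) ↔ (w ∈ A ∧ u = M w) := by
      constructor
      · rintro ⟨h1, rfl⟩; exact ⟨(hM u h1).1, (hM u h1).2.2.symm⟩
      · rintro ⟨h1, rfl⟩; exact ⟨(hM w h1).1, (hM w h1).2.2.symm⟩
    simp only [e, this]
  have hed : ∀ u, e u u = 0 := fun u => if_neg fun h => (hM u h.1).2.1 h.2.symm
  have hesum : ∀ u ∈ A, ∀ φ : V → ℝ, ∑ w ∈ A, e u w * φ w = φ (M u) := fun u hu φ => by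
    simp [e, hu, (hM u hu).1]
  have hedeg : ∀ u ∈ A, ∑ w ∈ A, e u w = 1 := fun u hu => by
    simpa using hesum u hu fun _ => 1
  have hecost : ∑ u ∈ A, ∑ w ∈ A, e u w * c u w = pmCost c A M :=
    Finset.sum_congr rfl fun u hu => hesum u hu (c u)
  let d : V → V → ℝ := fun u w => z u w - e u w
  have hds : ∀ u w, d u w = d w u := fun u w => by simp only [d, hz.symm u w, hes u w]
  have hdd : ∀ u, d u u = 0 := fun u => by simp only [d, hz.diag, hed, sub_self]
  have hddeg : ∀ u ∈ A, ∑ w ∈ A, d u w = 0 := fun u hu => by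
    simp only [d, Finset.sum_sub_distrib, hz.deg u hu, hedeg u hu, sub_self]
  have hdcost : ∑ u ∈ A, ∑ w ∈ A, d u w * c u w
      = ∑ u ∈ A, ∑ w ∈ A, z u w * c u w - pmCost c A M := by
    simp only [d, sub_mul, Finset.sum_sub_distrib, hecost]
  let ι := (V × V) ⊕ {S : Finset V // S ⊆ A ∧ Odd S.card}
  let a : ι → ℝ := Sum.elim (fun p => z p.1 p.2) fun S => cutIn A z S - 1
  let b : ι → ℝ := Sum.elim (fun p => d p.1 p.2) fun S => cutIn A d S
  have ha : ∀ i, 0 ≤ a i := by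
    rintro (p | S)
    · exact hz.nonneg _ _
    · exact sub_nonneg.2 (hz.cut S S.2.1 S.2.2)
  by_cases hb : ∃ j, b j < 0
  · obtain ⟨t, ht0, ht, j, hj, hj0⟩ := exists_first_zero a b ha hb
    let zt : V → V → ℝ := fun u w => z u w + t * d u w
    have hcut : ∀ S, cutIn A zt S = cutIn A z S + t * cutIn A d S := fun S => by
      simp only [cutIn, zt, Finset.sum_add_distrib, Finset.mul_sum]
    have hzt : FracPM A zt :=
      { nonneg := fun u w => ht (Sum.inl (u, w))
        symm := fun u w => by simp only [zt, hz.symm u w, hds u w]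
        diag := fun u => by simp only [zt, hz.diag, hdd, mul_zero, add_zero]
        deg := fun u hu => by
          simp only [zt, Finset.sum_add_distrib, ← Finset.mul_sum, hz.deg u hu, hddeg u hu,
            mul_zero, add_zero]
        cut := fun S hS ho => by
          have h : 0 ≤ cutIn A z S - 1 + t * cutIn A d S := ht (Sum.inr ⟨S, hS, ho⟩)
          rw [hcut]; linarith }
    have hle : ∑ u ∈ A, ∑ w ∈ A, zt u w * c u w ≤ ∑ u ∈ A, ∑ w ∈ A, z u w * c u w := by
      have : ∑ u ∈ A, ∑ w ∈ A, zt u w * c u w = ∑ u ∈ A, ∑ w ∈ A, z u w * c u w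
          + t * ∑ u ∈ A, ∑ w ∈ A, d u w * c u w := by
        simp only [zt, add_mul, Finset.sum_add_distrib, Finset.mul_sum, mul_assoc]
      rw [this, hdcost]
      have := mul_nonneg ht0 (sub_nonneg.2 hcost.le)
      linarith
    suffices h : ∃ m, IsPM A m ∧ pmCost c A m ≤ ∑ u ∈ A, ∑ w ∈ A, zt u w * c u w by
      obtain ⟨m, hm, h⟩ := h
      exact ⟨m, hm, h.trans hle⟩
    rcases j with ⟨u, w⟩ | ⟨S, hS, ho⟩
    · have hj : z u w - e u w < 0 := hj
      have hj0 : zt u w = 0 := hj0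
      have huw : u ∈ A ∧ w = M u := by
        by_contra h
        have : e u w = 0 := if_neg h
        linarith [hz.nonneg u w]
      refine ih _ ?_ zt hzt rfl
      rw [← hk]
      refine Finset.card_lt_card (Finset.ssubset_iff_of_subset (fun p hp => ?_) |>.2
        ⟨(u, w), ?_, ?_⟩)
      · simp only [Finset.mem_filter, Finset.mem_univ, true_and] at hp ⊢
        intro h
        apply hp
        have : e p.1 p.2 = 0 := if_neg fun h' => by
          rw [h'.2] at h
          exact (hpos _ h'.1).ne' h
        simp only [zt, d, h, this, sub_zero, mul_zero, add_zero]
      · simpa [huw.2] using (hpos u huw.1).ne'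
      · simpa using hj0
    · have hj : cutIn A d S < 0 := hj
      have hj0 : cutIn A z S - 1 + t * cutIn A d S = 0 := hj0
      have hne : ∀ T ⊆ A, Odd T.card → cutIn A d T < 0 → 1 < T.card := by
        intro T hT hTo hlt
        rcases (Nat.succ_le_of_lt hTo.pos).lt_or_eq with h | h
        · exact h
        · exfalso
          obtain ⟨v, rfl⟩ := Finset.card_eq_one.1 h.symm
          have hv := hT (Finset.mem_singleton_self v)
          rw [cutIn_singleton hdd hv, hddeg v hv] at hlt
          exact lt_irrefl _ hlt
      have hoT : Odd (A \ S).card := by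
        have := hz.even
        rw [← Finset.card_sdiff_add_card_eq_card hS, Nat.even_add] at this
        rw [← Nat.not_even_iff_odd] at ho ⊢
        tauto
      exact hzt.glue hS ho (hne S hS ho hj)
        (hne _ Finset.sdiff_subset hoT (by rwa [cutIn_sdiff hds hS]))
        (by rw [hcut]; linarith) hI c hc
  · push Not at hb
    exfalso
    have h0 : ∀ u ∈ A, ∀ w ∈ A, d u w = 0 := fun u hu w hw =>
      (Finset.sum_eq_zero_iff_of_nonneg fun w _ => hb (Sum.inl (u, w))).1 (hddeg u hu) w hw
    have : ∑ u ∈ A, ∑ w ∈ A, d u w * c u w = 0 :=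
      Finset.sum_eq_zero fun u hu => Finset.sum_eq_zero fun w hw => by rw [h0 u hu w hw, zero_mul]
    linarith

end Matching

section Join

variable {V : Type*} [Fintype V] [DecidableEq V]

lemma sum_sum_sym2 (g : Sym2 V → ℝ) :
    ∑ u, ∑ w, (if u = w then 0 else g s(u, w)) = 2 * ∑ e, if e.IsDiag then 0 else g e := by
  rw [← Finset.sum_product', Finset.univ_product_univ,
    ← Finset.sum_fiberwise Finset.univ fun p : V × V => s(p.1, p.2), Finset.mul_sum]
  refine Finset.sum_congr rfl fun e _ => ?_
  induction e using Sym2.ind with | _ a b =>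
  by_cases hab : a = b
  · subst hab
    simp only [Sym2.mk_isDiag_iff, if_true, mul_zero]
    refine Finset.sum_eq_zero fun p hp => if_pos ?_
    have := (Finset.mem_filter.1 hp).2
    rw [Sym2.eq_iff] at this
    rcases this with h | h <;> rw [h.1, h.2]
  · have : (Finset.univ.filter fun p : V × V => s(p.1, p.2) = s(a, b)) = {(a, b), (b, a)} := by
      ext ⟨p, q⟩
      simp
    rw [this, Finset.sum_pair (by simp [hab])]
    simp only [Sym2.mk_isDiag_iff, hab, Ne.symm hab, if_false]
    rw [Sym2.eq_swap (a := b)]; ring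

lemma cutVal_eq_sum (z : Sym2 V → ℝ) (S : Finset V) :
    cutVal z S = ∑ u ∈ S, ∑ w ∈ Sᶜ, z s(u, w) := by
  have h1 : cutVal z S = ∑ e, if e.IsDiag then 0 else z e * cutInd S e := by
    refine Finset.sum_congr rfl fun e _ => ?_
    induction e using Sym2.ind with | _ a b =>
    simp only [Sym2.mk_isDiag_iff]
    split_ifs with h
    · subst h
      rw [cutInd_mk, if_neg (by tauto), mul_zero]
    · rfl
  have h2 := sum_sum_sym2 fun e => z e * cutInd S e
  rw [← h1] at h2
  have h3 : ∑ u, ∑ w, (if u = w then 0 else z s(u, w) * cutInd S s(u, w))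
      = ∑ u ∈ S, ∑ w ∈ Sᶜ, z s(u, w) + ∑ u ∈ Sᶜ, ∑ w ∈ S, z s(u, w) := by
    rw [← Finset.sum_add_sum_compl S]
    congr 1
    · refine Finset.sum_congr rfl fun u hu => ?_
      rw [← Finset.sum_add_sum_compl S, Finset.sum_eq_zero, zero_add]
      · refine Finset.sum_congr rfl fun w hw => ?_
        have hw' := Finset.mem_compl.1 hw
        rw [if_neg (by rintro rfl; exact hw' hu), cutInd_mk, if_pos (Or.inl ⟨hu, hw'⟩), mul_one]
      · intro w hw
        have : cutInd S s(u, w) = 0 := by rw [cutInd_mk, if_neg (by tauto)]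
        simp [this]
    · refine Finset.sum_congr rfl fun u hu => ?_
      have hu' := Finset.mem_compl.1 hu
      rw [← Finset.sum_add_sum_compl S, add_comm, Finset.sum_eq_zero, zero_add]
      · refine Finset.sum_congr rfl fun w hw => ?_
        rw [if_neg (by rintro rfl; exact hu' hw), cutInd_mk, if_pos (Or.inr ⟨hu', hw⟩), mul_one]
      · intro w hw
        have hw' := Finset.mem_compl.1 hw
        have : cutInd S s(u, w) = 0 := by rw [cutInd_mk, if_neg (by tauto)]
        simp [this]
  have h4 : ∑ u ∈ Sᶜ, ∑ w ∈ S, z s(u, w) = ∑ u ∈ S, ∑ w ∈ Sᶜ, z s(u, w) := by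
    rw [Finset.sum_comm]
    exact Finset.sum_congr rfl fun u _ => Finset.sum_congr rfl fun w _ => by rw [Sym2.eq_swap]
  linarith

lemma isProper_odd (O : Finset V) (hO : Even O.card) :
    IsProper fun S : Finset V => if Odd (S ∩ O).card then (1 : ℝ) else 0 where
  compl S := by
    have h1 : (O \ S).card + (O ∩ S).card = O.card := Finset.card_sdiff_add_card_inter O S
    have h2 : Sᶜ ∩ O = O \ S := by ext; simp [and_comm]
    rw [← h1, Nat.even_add] at hO
    simp only [h2, Finset.inter_comm S O, ← Nat.not_even_iff_odd, hO]
  union A B h := by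
    have : ((A ∪ B) ∩ O).card = (A ∩ O).card + (B ∩ O).card := by
      rw [Finset.union_inter_distrib_right, Finset.card_union_of_disjoint]
      exact h.mono Finset.inter_subset_left Finset.inter_subset_left
    simp only [this, Nat.odd_add, ← Nat.not_odd_iff_even]
    split_ifs <;> (simp; try tauto)

/-- Weights covering all `O`-odd cuts dominate the cost of a perfect matching of `O`. -/
lemma exists_isPM_le (O : Finset V) (hO : Even O.card) (c : Sym2 V → ℝ) (hc0 : ∀ e, 0 ≤ c e)
    (hc : ∀ u v w, c s(u, w) ≤ c s(u, v) + c s(v, w)) (z : Sym2 V → ℝ) (hz : ∀ e, 0 ≤ z e)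
    (hcut : ∀ S : Finset V, Odd (S ∩ O).card → 1 ≤ cutVal z S) :
    ∃ m, IsPM O m ∧ ∑ v ∈ O, c s(v, m v) ≤ 2 * ∑ e, z e * c e := by
  obtain ⟨y, hy, hyc, hyd⟩ := exists_splitOff_cheap (isProper_odd O hO) c hc z
    ⟨hz, fun S => by
      split_ifs with h
      · exact hcut S h
      · exact cutVal_nonneg hz S⟩
  let ζ : V → V → ℝ := fun u w => if u = w then 0 else y s(u, w)
  have hζ0 : ∀ u w, 0 ≤ ζ u w := fun u w => by
    dsimp only [ζ]; split_ifs
    · rfl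
    · exact hy.nonneg _
  have hout : ∀ w ∉ O, ∀ u, ζ u w = 0 := by
    intro w hw u
    dsimp only [ζ]
    split_ifs with h
    · rfl
    have h1 := hyd w
    have h2 : ({w} : Finset V) ∩ O = ∅ := Finset.singleton_inter_of_notMem hw
    rw [h2, cutVal_singleton] at h1
    have h3 : ∑ a ∈ Finset.univ.erase w, y s(a, w) ≤ 0 := by simpa using h1
    exact (Finset.sum_eq_zero_iff_of_nonneg fun a _ => hy.nonneg _).1
      (le_antisymm h3 (Finset.sum_nonneg fun a _ => hy.nonneg _)) u (by simp [h])
  have hF : FracPM O ζ :=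
    { nonneg := hζ0
      symm := fun u w => by simp only [ζ, eq_comm (a := u), Sym2.eq_swap (a := u)]
      diag := fun u => if_pos rfl
      deg := fun u hu => by
        have h1 : ({u} : Finset V) ∩ O = {u} := by simpa using hu
        have h2 := hyd u
        have h3 := hy.cut {u}
        simp only [h1, Finset.card_singleton, odd_one, if_true] at h2 h3
        rw [max_eq_right zero_le_one] at h2
        rw [← le_antisymm h2 h3, cutVal_singleton, ← Finset.sum_erase_add _ _ hu]
        have h4 : ζ u u = 0 := if_pos rfl
        rw [h4, add_zero]
        refine (Finset.sum_subset_zero_on_sdiff (Finset.erase_subset_erase u O.subset_univ)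
          (fun w hw => ?_) fun w hw => ?_)
        · simp only [Finset.mem_sdiff, Finset.mem_erase, Finset.mem_univ, and_true] at hw
          rw [Sym2.eq_swap]
          have := hout w (by tauto) u
          simpa [ζ, Ne.symm hw.1] using this
        · rw [Sym2.eq_swap]
          exact if_neg (Finset.ne_of_mem_erase hw).symm
      cut := fun S hS ho => by
        have h1 := hy.cut S
        rw [Finset.inter_eq_left.2 hS, if_pos ho, cutVal_eq_sum] at h1
        refine h1.trans_eq (Finset.sum_congr rfl fun u hu => ?_)
        symm
        refine (Finset.sum_subset_zero_on_sdiff (fun w hw => ?_) (fun w hw => ?_) fun w hw => ?_)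
        · simp only [Finset.mem_sdiff, Finset.mem_compl] at hw ⊢
          exact hw.2
        · simp only [Finset.mem_sdiff, Finset.mem_compl] at hw
          have := hout w (by tauto) u
          rwa [show ζ u w = y s(u, w) from if_neg (by rintro rfl; exact hw.1 hu)] at this
        · exact if_neg (by rintro rfl; exact (Finset.mem_sdiff.1 hw).2 hu) }
  obtain ⟨m, hm, hmc⟩ := integral O ζ hF (fun u w => c s(u, w)) fun u w => by rw [Sym2.eq_swap]
  refine ⟨m, hm, hmc.trans ?_⟩
  have h1 : ∑ u ∈ O, ∑ w ∈ O, ζ u w * c s(u, w)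
      ≤ ∑ u, ∑ w, (if u = w then 0 else y s(u, w) * c s(u, w)) := by
    have h2 : ∀ u w, ζ u w * c s(u, w) = if u = w then 0 else y s(u, w) * c s(u, w) := by
      intro u w; dsimp only [ζ]; split_ifs <;> simp
    simp only [← h2]
    have h0 : ∀ u w, 0 ≤ ζ u w * c s(u, w) := fun u w => mul_nonneg (hζ0 u w) (hc0 _)
    refine (Finset.sum_le_sum fun u _ => Finset.sum_le_sum_of_subset_of_nonneg O.subset_univ
      fun w _ _ => h0 u w).trans ?_
    exact Finset.sum_le_sum_of_subset_of_nonneg O.subset_univ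
      fun u _ _ => Finset.sum_nonneg fun w _ => h0 u w
  refine h1.trans ?_
  rw [sum_sum_sym2 fun e => y e * c e]
  refine mul_le_mul_of_nonneg_left (le_trans (Finset.sum_le_sum fun e _ => ?_) hyc) zero_le_two
  split_ifs
  · exact mul_nonneg (hy.nonneg e) (hc0 e)
  · rfl

end Join

section Euler

variable {V : Type*} [Fintype V] [DecidableEq V]

/-- The number of ends of `e` at `v`. -/
def inc (v : V) : Sym2 V → ℕ :=
  Sym2.lift ⟨fun a b => (if a = v then 1 else 0) + (if b = v then 1 else 0),
    fun _ _ => add_comm _ _⟩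

lemma inc_mk (v a b : V) :
    inc v s(a, b) = (if a = v then 1 else 0) + (if b = v then 1 else 0) := rfl

/-- The degree of `v` in a multigraph. -/
def mdeg (M : Multiset (Sym2 V)) (v : V) : ℕ := (M.map (inc v)).sum

lemma mdeg_add (M N : Multiset (Sym2 V)) (v : V) : mdeg (M + N) v = mdeg M v + mdeg N v := by
  simp [mdeg]

lemma mdeg_cons (e : Sym2 V) (N : Multiset (Sym2 V)) (v : V) :
    mdeg (e ::ₘ N) v = inc v e + mdeg N v := by
  simp [mdeg]

/-- The cost of traversing a list of vertices. -/
def walkCost (c : Sym2 V → ℝ) : List V → ℝ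
  | [] => 0
  | [_] => 0
  | a :: b :: l => c s(a, b) + walkCost c (b :: l)

lemma walkCost_append (c : Sym2 V → ℝ) (x y : V) (xs ys : List V) :
    walkCost c (xs ++ x :: y :: ys) = walkCost c (xs ++ [x]) + c s(x, y) + walkCost c (y :: ys) := by
  induction xs with
  | nil => simp [walkCost]
  | cons a xs ih =>
    cases xs with
    | nil => simp [walkCost]; ring
    | cons b xs =>
      simp only [List.cons_append, walkCost] at ih ⊢
      rw [ih]; ring

lemma sum_filter_add_not (c : Sym2 V → ℝ) (M : Multiset (Sym2 V)) (P : Sym2 V → Prop)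
    [DecidablePred P] :
    ((M.filter P).map c).sum + ((M.filter fun e => ¬ P e).map c).sum = (M.map c).sum := by
  rw [← Multiset.sum_add, ← Multiset.map_add, Multiset.filter_add_not]

/-- Euler's theorem in the form of cheap covering walks. -/
lemma exists_walk (c : Sym2 V → ℝ) (hc0 : ∀ e, 0 ≤ c e) (hcd : ∀ a, c s(a, a) = 0)
    (M : Multiset (Sym2 V)) (a b : V)
    (h : ∀ v, Even (mdeg M v + ((if a = v then 1 else 0) + if b = v then 1 else 0))) :
    Reach M.toFinset a b ∧ ∃ l : List V, walkCost c (a :: l ++ [b]) ≤ (M.map c).sum ∧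
      ∀ v, Reach M.toFinset a v → v ∈ a :: l ++ [b] := by
  classical
  obtain ⟨n, hn⟩ : ∃ n, M.card = n := ⟨_, rfl⟩
  induction n using Nat.strong_induction_on generalizing M a b with
  | _ n ih =>
  have hM0 : 0 ≤ (M.map c).sum := Multiset.sum_nonneg fun x hx => by
    obtain ⟨e, -, rfl⟩ := Multiset.mem_map.1 hx
    exact hc0 e
  by_cases hex : ∃ a', s(a, a') ∈ M
  swap
  · push Not at hex
    have hd : mdeg M a = 0 := Multiset.sum_eq_zero fun x hx => by
      obtain ⟨e, he, rfl⟩ := Multiset.mem_map.1 hx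
      induction e using Sym2.ind with | _ p q =>
      have h1 : p ≠ a := by rintro rfl; exact hex _ he
      have h2 : q ≠ a := by rintro rfl; exact hex _ (by rwa [Sym2.eq_swap])
      simp [inc_mk, h1, h2]
    have hab : a = b := by
      by_contra hab
      have := h a
      simp [hd, Ne.symm hab] at this
    subst hab
    refine ⟨Relation.ReflTransGen.refl, [], by simpa [walkCost, hcd] using hM0, fun v hv => ?_⟩
    rcases Relation.ReflTransGen.cases_head hv with rfl | ⟨w, hw, -⟩
    · simp
    · exact absurd (Multiset.mem_toFinset.1 hw) (hex w)
  obtain ⟨a', ha'⟩ := hex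
  obtain ⟨N, rfl⟩ := Multiset.exists_cons_of_mem ha'
  rw [Multiset.card_cons] at hn
  have hN : ∀ v, Even (mdeg N v + ((if a' = v then 1 else 0) + if b = v then 1 else 0)) := by
    intro v
    have := h v
    rw [mdeg_cons, inc_mk] at this
    rw [Nat.even_iff] at this ⊢
    omega
  obtain ⟨hb, l, hl, hcov⟩ := ih N.card (by omega) N a' b hN rfl
  have hsub : N.toFinset ⊆ (s(a, a') ::ₘ N).toFinset := by
    rw [Multiset.toFinset_cons]; exact Finset.subset_insert _ _
  have hedge : Reach (s(a, a') ::ₘ N).toFinset a a' := Reach.of_mem (by simp)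
  refine ⟨hedge.trans (hb.mono hsub), ?_⟩
  by_cases haa : Reach N.toFinset a' a
  · refine ⟨a' :: l, ?_, fun v hv => ?_⟩
    · simpa [walkCost] using hl
    · refine List.mem_cons_of_mem _ (hcov v (haa.trans (hv.simulate fun p q hpq => ?_)))
      rw [Multiset.toFinset_cons, Finset.mem_insert] at hpq
      rcases hpq with hpq | hpq
      · rcases Sym2.eq_iff.1 hpq with ⟨rfl, rfl⟩ | ⟨rfl, rfl⟩
        · exact haa.symm
        · exact haa
      · exact Reach.of_mem hpq
  · let P : Sym2 V → Prop := fun e => ∃ p ∈ e, Reach N.toFinset a p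
    have hP : ∀ p q, s(p, q) ∈ N → (P s(p, q) ↔ Reach N.toFinset a p) := by
      intro p q hpq
      have hpq' : Reach N.toFinset p q := Reach.of_mem (Multiset.mem_toFinset.2 hpq)
      simp only [P, Sym2.mem_iff]
      constructor
      · rintro ⟨_, rfl | rfl, h⟩
        · exact h
        · exact h.trans hpq'.symm
      · exact fun h => ⟨p, Or.inl rfl, h⟩
    have hz : ∀ v, ∀ e ∈ N, (P e ↔ Reach N.toFinset a v) ∨ inc v e = 0 := by
      intro v e he
      induction e using Sym2.ind with | _ p q =>
      by_cases h1 : p = v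
      · exact Or.inl (h1 ▸ hP p q he)
      · by_cases h2 : q = v
        · rw [Sym2.eq_swap] at he ⊢
          exact Or.inl (h2 ▸ hP q p he)
        · right; simp [inc_mk, h1, h2]
    have hsum := Multiset.filter_add_not P N
    have hdsum : ∀ v, mdeg (N.filter P) v + mdeg (N.filter fun e => ¬ P e) v = mdeg N v := by
      intro v; rw [← mdeg_add, hsum]
    have hd1 : ∀ v, ¬ Reach N.toFinset a v → mdeg (N.filter P) v = 0 := by
      refine fun v hv => Multiset.sum_eq_zero fun x hx => ?_
      obtain ⟨e, he, rfl⟩ := Multiset.mem_map.1 hx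
      obtain ⟨he, hPe⟩ := Multiset.mem_filter.1 he
      exact (hz v e he).resolve_left fun h => hv (h.1 hPe)
    have hd2 : ∀ v, Reach N.toFinset a v → mdeg (N.filter fun e => ¬ P e) v = 0 := by
      refine fun v hv => Multiset.sum_eq_zero fun x hx => ?_
      obtain ⟨e, he, rfl⟩ := Multiset.mem_map.1 hx
      obtain ⟨he, hPe⟩ := Multiset.mem_filter.1 he
      exact (hz v e he).resolve_left fun h => hPe (h.2 hv)
    have hne : ∀ v, Reach N.toFinset a v → a' ≠ v ∧ b ≠ v := by
      refine fun v hv => ⟨?_, ?_⟩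
      · rintro rfl; exact haa hv.symm
      · rintro rfl; exact haa (hb.trans hv.symm)
    have hc1 : (N.filter P).card ≤ N.card := Multiset.card_le_card (Multiset.filter_le _ _)
    have hc2 : (N.filter fun e => ¬ P e).card ≤ N.card :=
      Multiset.card_le_card (Multiset.filter_le _ _)
    obtain ⟨-, l₁, hl₁, hcov₁⟩ := ih (N.filter P).card (by omega) (N.filter P) a a (fun v => by
      by_cases hv : Reach N.toFinset a v
      · have := hN v
        have h1 := hdsum v
        rw [hd2 v hv, add_zero] at h1
        rw [if_neg (hne v hv).1, if_neg (hne v hv).2] at this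
        rw [h1, Nat.even_iff] at *
        omega
      · rw [hd1 v hv, Nat.even_iff]; omega) rfl
    obtain ⟨-, l₂, hl₂, hcov₂⟩ := ih (N.filter fun e => ¬ P e).card (by omega)
      (N.filter fun e => ¬ P e) a' b (fun v => by
      by_cases hv : Reach N.toFinset a v
      · rw [hd2 v hv, if_neg (hne v hv).1, if_neg (hne v hv).2]; simp
      · have h1 := hdsum v
        rw [hd1 v hv, zero_add] at h1
        rw [h1]; exact hN v) rfl
    refine ⟨l₁ ++ [a] ++ a' :: l₂, ?_, fun v hv => ?_⟩
    · have h1 : a :: (l₁ ++ [a] ++ a' :: l₂) ++ [b] = (a :: l₁) ++ a :: a' :: (l₂ ++ [b]) := by simp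
      rw [h1, walkCost_append, Multiset.map_cons, Multiset.sum_cons, ← sum_filter_add_not c N P]
      simp only [List.cons_append] at hl₁ hl₂ ⊢
      linarith
    · have key : Reach N.toFinset a v ∨ Reach N.toFinset a' v := by
        induction hv with
        | refl => exact Or.inl Relation.ReflTransGen.refl
        | tail _ hpq ih =>
          rw [Multiset.toFinset_cons, Finset.mem_insert] at hpq
          rcases hpq with hpq | hpq
          · rcases Sym2.eq_iff.1 hpq with ⟨rfl, rfl⟩ | ⟨rfl, rfl⟩
            · exact Or.inr Relation.ReflTransGen.refl
            · exact Or.inl Relation.ReflTransGen.refl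
          · exact ih.imp (fun h => h.trans (Reach.of_mem hpq)) fun h => h.trans (Reach.of_mem hpq)
      have h1 : ∀ v, Reach N.toFinset a v → Reach (N.filter P).toFinset a v := by
        intro v hv
        induction hv with
        | refl => exact Relation.ReflTransGen.refl
        | tail hp hpq ih =>
          refine ih.trans (Reach.of_mem ?_)
          rw [Multiset.mem_toFinset] at hpq ⊢
          exact Multiset.mem_filter.2 ⟨hpq, (hP _ _ hpq).2 hp⟩
      have h2 : ∀ v, Reach N.toFinset a' v → Reach (N.filter fun e => ¬ P e).toFinset a' v := by
        intro v hv
        induction hv with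
        | refl => exact Relation.ReflTransGen.refl
        | tail hp hpq ih =>
          refine ih.trans (Reach.of_mem ?_)
          rw [Multiset.mem_toFinset] at hpq ⊢
          exact Multiset.mem_filter.2 ⟨hpq, fun h => haa
            (Reach.trans hp ((hP _ _ hpq).1 h).symm)⟩
      rcases key with hv | hv
      · have := hcov₁ v (h1 v hv)
        simp only [List.mem_cons, List.mem_append, List.not_mem_nil] at this ⊢
        tauto
      · have := hcov₂ v (h2 v hv)
        simp only [List.mem_cons, List.mem_append, List.not_mem_nil] at this ⊢
        tauto

lemma walkCost_sublist {c : Sym2 V → ℝ} (hc : ∀ u v w, c s(u, w) ≤ c s(u, v) + c s(v, w)) {l l' : List V} (h : l'.Sublist l)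
    (a b : V) : walkCost c (a :: l' ++ [b]) ≤ walkCost c (a :: l ++ [b]) := by
  induction h generalizing a with
  | slnil => rfl
  | @cons l₁ l₂ x _ ih =>
    refine (?_ : _ ≤ c s(a, x) + walkCost c (x :: l₁ ++ [b])).trans ?_
    · cases l₁ with
      | nil => simpa [walkCost] using hc a x b
      | cons y l₁ => simp only [List.cons_append, walkCost]; linarith [hc a x y]
    · simp only [List.cons_append, walkCost] at ih ⊢; linarith [ih x]
  | @cons_cons l₁ l₂ x _ ih =>
    simp only [List.cons_append, walkCost] at ih ⊢; linarith [ih x]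

lemma sum_zip_eq_walkCost {c : Finset V → ℝ} {c' : Sym2 V → ℝ}
    (hcc : ∀ u v, u ≠ v → c {u, v} = c' s(u, v)) (l : List V) (a b : V) (hl : (a :: l).Nodup)
    (hb : b ∉ l) (hab : l ≠ [] ∨ a ≠ b) :
    (((a :: l).zip (l ++ [b])).map fun p => c {p.1, p.2}).sum = walkCost c' (a :: l ++ [b]) := by
  induction l generalizing a with
  | nil =>
    have : a ≠ b := by simpa using hab
    simp [walkCost, hcc a b this]
  | cons x l ih =>
    have hax : a ≠ x := by rintro rfl; simp at hl
    have hxb : x ≠ b := by rintro rfl; simp at hb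
    have := ih x hl.of_cons (by simp at hb; tauto) (Or.inr hxb)
    simp only [List.cons_append, List.zip_cons_cons, List.map_cons, List.sum_cons, walkCost] at *
    rw [this, hcc a x hax]

/-- Shortcutting an Eulerian multigraph to a tour. -/
lemma exists_tour {c : Finset V → ℝ} {c' : Sym2 V → ℝ}
    (hcc : ∀ u v, u ≠ v → c {u, v} = c' s(u, v)) (hc0 : ∀ e, 0 ≤ c' e)
    (hcd : ∀ a, c' s(a, a) = 0) (hc : ∀ u v w, c' s(u, w) ≤ c' s(u, v) + c' s(v, w))
    (M : Multiset (Sym2 V)) (r : V) (hM : ∀ v, Even (mdeg M v)) :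
    ∃ t : List V, t.Nodup ∧ t.head? = some r ∧ tourCost c t ≤ (M.map c').sum ∧
      ∀ v, Reach M.toFinset r v → v ∈ t := by
  obtain ⟨-, l, hl, hcov⟩ := exists_walk c' hc0 hcd M r r fun v => by
    have := hM v
    rw [Nat.even_iff] at this ⊢
    omega
  let l' := (l.filter (· ≠ r)).dedup
  have hsub : l'.Sublist l := (List.dedup_sublist _).trans List.filter_sublist
  have hrl : r ∉ l' := by simp [l']
  have hnd : (r :: l').Nodup := List.nodup_cons.2 ⟨hrl, List.nodup_dedup _⟩
  refine ⟨r :: l', hnd, rfl, ?_, fun v hv => ?_⟩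
  · unfold tourCost
    split_ifs with h
    · exact Multiset.sum_nonneg fun x hx => by
        obtain ⟨e, -, rfl⟩ := Multiset.mem_map.1 hx
        exact hc0 e
    · have hne : l' ≠ [] := by rintro h'; rw [h'] at h; simp at h
      have : (r :: l').rotate 1 = l' ++ [r] := by simp
      rw [this, sum_zip_eq_walkCost hcc l' r r hnd hrl (Or.inl hne)]
      exact (walkCost_sublist hc hsub r r).trans hl
  · have := hcov v hv
    by_cases hvr : v = r
    · simp [hvr]
    · simp [l', hvr] at this ⊢; exact this

end Euler

section RootedTrees

variable {V : Type*} [Fintype V] [DecidableEq V]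

/-- `par` and `rk` are the parent and rank functions of a tree on `U` rooted at `r`. -/
structure IsRooted (r : V) (U : Finset V) (par : V → V) (rk : V → ℕ) : Prop where
  root_mem : r ∈ U
  par_mem : ∀ v ∈ U, v ≠ r → par v ∈ U
  rk_lt : ∀ v ∈ U, v ≠ r → rk (par v) < rk v

lemma exists_isRooted (T : Finset (Sym2 V)) (r : V) :
    ∃ (W : Finset V) (par : V → V) (rk : V → ℕ), (∀ v, v ∈ W ↔ Reach T r v) ∧
      IsRooted r W par rk ∧ ∀ v ∈ W, v ≠ r → s(v, par v) ∈ T := by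
  classical
  let R : ℕ → Set V := fun n => Nat.rec {r} (fun _ A => {b | ∃ a ∈ A, s(a, b) ∈ T}) n
  have hR : ∀ v, Reach T r v → ∃ n, v ∈ R n := by
    intro v hv
    induction hv with
    | refl => exact ⟨0, rfl⟩
    | tail _ h ih =>
      obtain ⟨n, hn⟩ := ih
      exact ⟨n + 1, _, hn, h⟩
  have hR' : ∀ n v, v ∈ R n → Reach T r v := by
    intro n
    induction n with
    | zero => intro v hv; rw [show v = r from hv]; exact Relation.ReflTransGen.refl
    | succ n ih =>
      rintro v ⟨a, ha, h⟩
      exact (ih a ha).trans (Reach.of_mem h)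
  let rk : V → ℕ := fun v => sInf {n | v ∈ R n}
  have hpar : ∀ v, ∃ w, Reach T r v → v ≠ r → Reach T r w ∧ rk w < rk v ∧ s(v, w) ∈ T := by
    intro v
    by_cases hv : Reach T r v ∧ v ≠ r
    swap
    · exact ⟨v, fun h1 h2 => absurd ⟨h1, h2⟩ hv⟩
    have hm : v ∈ R (rk v) := Nat.sInf_mem (s := {n | v ∈ R n}) (hR v hv.1)
    cases hk : rk v with
    | zero => rw [hk] at hm; exact absurd hm hv.2
    | succ m =>
      rw [hk] at hm
      obtain ⟨a, ha, h⟩ := hm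
      refine ⟨a, fun _ _ => ⟨hR' _ _ ha, ?_, by rwa [Sym2.eq_swap]⟩⟩
      exact Nat.lt_succ_of_le (Nat.sInf_le (s := {n | a ∈ R n}) ha)
  choose par hpar using hpar
  refine ⟨Finset.univ.filter (Reach T r), par, rk, by simp, ⟨?_, ?_, ?_⟩, ?_⟩
  · exact Finset.mem_filter.2 ⟨Finset.mem_univ _, Relation.ReflTransGen.refl⟩
  · intro v hv hr
    simpa using (hpar v (by simpa using hv) hr).1
  · intro v hv hr
    exact (hpar v (by simpa using hv) hr).2.1
  · intro v hv hr
    exact (hpar v (by simpa using hv) hr).2.2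

namespace IsRooted

variable {r : V} {U : Finset V} {par : V → V} {rk : V → ℕ}

lemma par_ne (h : IsRooted r U par rk) {v : V} (hv : v ∈ U) (hr : v ≠ r) : v ≠ par v := by
  intro h'
  have := h.rk_lt v hv hr
  rw [← h'] at this
  exact lt_irrefl _ this

lemma injOn (h : IsRooted r U par rk) :
    Set.InjOn (fun v => s(v, par v)) (U.erase r : Finset V) := by
  intro v hv w hw hvw
  simp only [Finset.coe_erase, Set.mem_sdiff, Finset.mem_coe, Set.mem_singleton_iff] at hv hw
  rcases Sym2.eq_iff.1 hvw with ⟨h1, -⟩ | ⟨h1, h2⟩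
  · exact h1
  · have h3 := h.rk_lt v hv.1 hv.2
    have h4 := h.rk_lt w hw.1 hw.2
    rw [h2] at h3
    rw [← h1] at h4
    omega

lemma sum_le (h : IsRooted r U par rk) {T : Finset (Sym2 V)}
    (hT : ∀ v ∈ U, v ≠ r → s(v, par v) ∈ T) {c : Sym2 V → ℝ} (hc : ∀ e, 0 ≤ c e) :
    ∑ v ∈ U.erase r, c s(v, par v) ≤ ∑ e, inT e T * c e := by
  have h1 : ∑ v ∈ U.erase r, c s(v, par v)
      = ∑ e ∈ (U.erase r).image (fun v => s(v, par v)), c e :=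
    (Finset.sum_image h.injOn).symm
  have h2 : ∑ e, inT e T * c e = ∑ e ∈ T, c e := by
    simp [inT, Finset.sum_ite_mem]
  rw [h1, h2]
  refine Finset.sum_le_sum_of_subset_of_nonneg (fun e he => ?_) fun e _ _ => hc e
  obtain ⟨v, hv, rfl⟩ := Finset.mem_image.1 he
  exact hT v (Finset.mem_of_mem_erase hv) (Finset.ne_of_mem_erase hv)

/-- The edges of a rooted tree. -/
def edges (r : V) (U : Finset V) (par : V → V) : Multiset (Sym2 V) :=
  (U.erase r).val.map fun v => s(v, par v)

lemma mem_iff_root_mem (h : IsRooted r U par rk) {S : Finset V} {n : ℕ}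
    (hS : ∀ b ∈ U, b ≠ r → rk b ≤ n → (b ∈ S ↔ par b ∈ S)) {a : V} (ha : a ∈ U) (hn : rk a ≤ n) :
    a ∈ S ↔ r ∈ S := by
  obtain ⟨k, hk⟩ : ∃ k, rk a = k := ⟨_, rfl⟩
  induction k using Nat.strong_induction_on generalizing a with
  | _ k ih =>
  by_cases har : a = r
  · rw [har]
  · have h1 := h.rk_lt a ha har
    rw [hS a ha har hn]
    exact ih _ (by omega) (h.par_mem a ha har) (by omega) rfl

/-- The parent relation of a rooted tree. -/
def Step (r : V) (U : Finset V) (par : V → V) (a b : V) : Prop := a ∈ U ∧ a ≠ r ∧ b = par a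

lemma rk_le_of_path (h : IsRooted r U par rk) {w v : V}
    (hp : Relation.ReflTransGen (Step r U par) w v) : rk v ≤ rk w := by
  induction hp with
  | refl => rfl
  | tail _ hs ih =>
    obtain ⟨h1, h2, rfl⟩ := hs
    exact (h.rk_lt _ h1 h2).le.trans ih

lemma mem_iff_of_path (h : IsRooted r U par rk) {S : Finset V} {w v : V}
    (hp : Relation.ReflTransGen (Step r U par) w v)
    (hS : ∀ b ∈ U, b ≠ r → rk v < rk b → (b ∈ S ↔ par b ∈ S)) : w ∈ S ↔ v ∈ S := by
  induction hp using Relation.ReflTransGen.head_induction_on with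
  | refl => rfl
  | head hs hp ih =>
    obtain ⟨h1, h2, rfl⟩ := hs
    rw [hS _ h1 h2 ((h.rk_le_of_path hp).trans_lt (h.rk_lt _ h1 h2)), ih]

lemma mdeg_edges (v : V) : mdeg (edges r U par) v
    = ∑ a ∈ U.erase r, ((if a = v then 1 else 0) + if par a = v then 1 else 0) := by
  simp only [mdeg, edges, Multiset.map_map, Function.comp_def, inc_mk]
  rfl

/-- The vertices of odd degree. -/
def odds (r : V) (U : Finset V) (par : V → V) : Finset V :=
  Finset.univ.filter fun v => Odd (mdeg (edges r U par) v)

/-- The tree edges crossing `S`, represented by their lower end. -/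
def crossing (r : V) (U : Finset V) (par : V → V) (S : Finset V) : Finset V :=
  (U.erase r).filter fun a => ¬ (a ∈ S ↔ par a ∈ S)

lemma odd_crossing_iff (S : Finset V) :
    Odd (crossing r U par S).card ↔ Odd (S ∩ odds r U par).card := by
  have h1 : Odd (∑ v ∈ S, mdeg (edges r U par) v) ↔ Odd (S ∩ odds r U par).card := by
    rw [Finset.odd_sum_iff_odd_card_odd, odds, Finset.inter_filter, Finset.inter_univ]
  rw [← h1]
  simp only [mdeg_edges]
  rw [Finset.sum_comm, Finset.odd_sum_iff_odd_card_odd]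
  rw [crossing]
  refine iff_of_eq (congrArg (fun A : Finset V => Odd A.card) (Finset.filter_congr fun a _ => ?_))
  simp only [Finset.sum_add_distrib, Finset.sum_ite_eq]
  by_cases h1 : a ∈ S <;> by_cases h2 : par a ∈ S <;> simp [h1, h2]

lemma even_card_odds : Even (odds r U par).card := by
  have h := odd_crossing_iff (r := r) (U := U) (par := par) Finset.univ
  rw [Finset.univ_inter] at h
  rw [← Nat.not_odd_iff_even, ← h]
  simp [crossing]

lemma cutInd_edge (S : Finset V) (a : V) :
    cutInd S s(a, par a) = if ¬ (a ∈ S ↔ par a ∈ S) then 1 else 0 := by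
  rw [cutInd_mk]
  congr 1
  simp only [eq_iff_iff]; tauto

end IsRooted

open IsRooted

lemma cutVal_join {r : V} {U : Finset V} {par : V → V} (x : Sym2 V → ℝ) (β : ℝ) (a : V → ℝ)
    (g : Sym2 V → ℝ) :
    ∑ e, (β * x e + ∑ v ∈ U.erase r, if e = s(v, par v) then a v else 0) * g e
      = β * ∑ e, x e * g e + ∑ v ∈ U.erase r, a v * g s(v, par v) := by
  simp only [add_mul, Finset.sum_add_distrib, Finset.sum_mul, Finset.mul_sum, mul_assoc]
  congr 1
  rw [Finset.sum_comm]
  refine Finset.sum_congr rfl fun v _ => ?_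
  simp [ite_mul]

/-- The tree join bound: correct parities using a scaled LP solution plus part of the tree. -/
lemma one_le_cutVal_join {r : V} {U : Finset V} {par : V → V} {rk : V → ℕ}
    (h : IsRooted r U par rk) {x : Sym2 V → ℝ} {y η : V → ℝ} {β δ : ℝ} (hβ : 0 ≤ β)
    (hβ1 : 2 * β ≤ 1) (hβδ : β * (3 - δ) = 1)
    (hcut : ∀ S : Finset V, r ∉ S → ∀ v ∈ S, v ∈ U → 2 * y v ≤ cutVal x S)
    (hyδ : ∀ v ∈ U, v ≠ r → δ ≤ y v) (hη1 : ∀ v, η v ≤ 1)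
    (hpath : ∀ v ∈ U, v ≠ r → ∃ w ∈ U, Relation.ReflTransGen (Step r U par) w v ∧ y w = η v)
    {S : Finset V} (hS : Odd (S ∩ odds r U par).card) :
    1 ≤ cutVal (fun e => β * x e
      + ∑ v ∈ U.erase r, if e = s(v, par v) then 1 - 2 * β * η v else 0) S := by
  wlog hr : r ∉ S generalizing S
  · have h1 : Odd (Sᶜ ∩ odds r U par).card := by
      have h2 := Finset.card_inter_add_card_sdiff (odds r U par) S
      have h3 : Sᶜ ∩ odds r U par = odds r U par \ S := by ext; simp [and_comm]
      have h4 := even_card_odds (r := r) (U := U) (par := par)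
      rw [h3]
      rw [Finset.inter_comm] at hS
      rw [Nat.odd_iff] at *
      rw [Nat.even_iff] at h4
      omega
    rw [← cutVal_compl]
    exact this h1 (by simpa using hr)
  rw [cutVal, cutVal_join, ← cutVal]
  have hsum : ∑ v ∈ U.erase r, (1 - 2 * β * η v) * cutInd S s(v, par v)
      = ∑ v ∈ crossing r U par S, (1 - 2 * β * η v) := by
    rw [crossing, Finset.sum_filter]
    refine Finset.sum_congr rfl fun v _ => ?_
    rw [cutInd_edge]; split_ifs <;> simp
  rw [hsum]
  have hodd := (odd_crossing_iff S).2 hS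
  have hcr : ∀ v, v ∈ crossing r U par S ↔ (v ∈ U ∧ v ≠ r) ∧ ¬ (v ∈ S ↔ par v ∈ S) := by
    intro v; simp [crossing, and_comm]
  by_cases hone : (crossing r U par S).card = 1
  · obtain ⟨v, hv⟩ := Finset.card_eq_one.1 hone
    have hvc : v ∈ crossing r U par S := by simp [hv]
    obtain ⟨⟨hvU, hvr⟩, hvS⟩ := (hcr v).1 hvc
    have hnc : ∀ b ∈ U, b ≠ r → b ≠ v → (b ∈ S ↔ par b ∈ S) := by
      intro b hb hbr hbv
      by_contra hcon
      have := (hcr b).2 ⟨⟨hb, hbr⟩, hcon⟩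
      rw [hv, Finset.mem_singleton] at this
      exact hbv this
    have hlt := h.rk_lt v hvU hvr
    have hps : par v ∉ S := by
      rw [h.mem_iff_root_mem (n := rk (par v)) (fun b hb hbr hbn => hnc b hb hbr ?_)
        (h.par_mem v hvU hvr) le_rfl]
      · exact hr
      · rintro rfl; omega
    have hvS' : v ∈ S := by tauto
    obtain ⟨w, hwU, hwv, hyw⟩ := hpath v hvU hvr
    have hwS : w ∈ S := (h.mem_iff_of_path hwv fun b hb hbr hlt =>
      hnc b hb hbr (by rintro rfl; exact lt_irrefl _ hlt)).2 hvS'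
    have := mul_le_mul_of_nonneg_left (hcut S hr w hwS hwU) hβ
    rw [hv, Finset.sum_singleton, ← hyw]
    linarith
  · have h3 : 3 ≤ (crossing r U par S).card := by
      rw [Nat.odd_iff] at hodd; omega
    obtain ⟨v, hv⟩ := Finset.card_pos.1 (show 0 < (crossing r U par S).card by omega)
    obtain ⟨⟨hvU, hvr⟩, hvS⟩ := (hcr v).1 hv
    obtain ⟨w, hwU, hwS⟩ : ∃ w ∈ U, w ∈ S := by
      by_cases hvS' : v ∈ S
      · exact ⟨v, hvU, hvS'⟩
      · exact ⟨par v, h.par_mem v hvU hvr, by tauto⟩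
    have hwδ : δ ≤ y w := hyδ w hwU (by rintro rfl; exact hr hwS)
    have h4 := mul_le_mul_of_nonneg_left ((mul_le_mul_of_nonneg_left hwδ zero_le_two).trans
      (hcut S hr w hwS hwU)) hβ
    have h5 : ((crossing r U par S).card : ℝ) * (1 - 2 * β)
        ≤ ∑ v ∈ crossing r U par S, (1 - 2 * β * η v) := by
      rw [← nsmul_eq_mul]
      refine Finset.card_nsmul_le_sum _ _ _ fun v _ => ?_
      nlinarith [hη1 v]
    have h6 : (3:ℝ) ≤ (crossing r U par S).card := by exact_mod_cast h3
    nlinarith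

/-- The edges of a perfect matching. -/
lemma exists_matching_edges {O : Finset V} {m : V → V} (hm : IsPM O m) (c : Sym2 V → ℝ) :
    ∃ N : Multiset (Sym2 V), (∀ v, mdeg N v = if v ∈ O then 1 else 0) ∧
      2 * (N.map c).sum = ∑ v ∈ O, c s(v, m v) := by
  have hfib : ∀ v ∈ O, O.filter (fun a => s(a, m a) = s(v, m v)) = {v, m v} := by
    intro v hv
    obtain ⟨h1, h2, h3⟩ := hm v hv
    ext a
    simp only [Finset.mem_filter, Finset.mem_insert, Finset.mem_singleton, Sym2.eq_iff]
    constructor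
    · rintro ⟨-, ⟨h, -⟩ | ⟨h, -⟩⟩
      · exact Or.inl h
      · exact Or.inr h
    · rintro (rfl | rfl)
      · exact ⟨hv, Or.inl ⟨rfl, rfl⟩⟩
      · exact ⟨h1, Or.inr ⟨rfl, h3⟩⟩
  have key : ∀ {A : Type} [AddCommMonoid A] (g : Sym2 V → A),
      ∑ v ∈ O, g s(v, m v) = 2 • ∑ e ∈ O.image (fun v => s(v, m v)), g e := by
    intro A _ g
    rw [← Finset.sum_fiberwise_of_maps_to (t := O.image fun v => s(v, m v))
      (g := fun v => s(v, m v)) (fun v hv => Finset.mem_image_of_mem _ hv), Finset.smul_sum]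
    refine Finset.sum_congr rfl fun e he => ?_
    obtain ⟨v, hv, rfl⟩ := Finset.mem_image.1 he
    rw [hfib v hv, Finset.sum_pair (hm v hv).2.1.symm, (hm v hv).2.2, Sym2.eq_swap (a := m v),
      two_smul]
  refine ⟨(O.image fun v => s(v, m v)).val, fun v => ?_, ?_⟩
  · have h1 := key (inc v)
    have h2 : mdeg (O.image fun v => s(v, m v)).val v
      = ∑ e ∈ O.image (fun v => s(v, m v)), inc v e := rfl
    rw [h2]
    simp only [inc_mk, Finset.sum_add_distrib, Finset.sum_ite_eq', smul_eq_mul] at h1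
    have h3 : ∑ a ∈ O, (if m a = v then 1 else 0) = if v ∈ O then 1 else 0 := by
      split_ifs with hv
      · rw [Finset.sum_eq_single_of_mem (m v) (hm v hv).1, if_pos (hm v hv).2.2]
        intro b hb hbv
        rw [if_neg]
        rintro rfl
        exact hbv (hm b hb).2.2.symm
      · refine Finset.sum_eq_zero fun a ha => if_neg ?_
        rintro rfl
        exact hv (hm a ha).1
    rw [h3] at h1
    omega
  · have h1 := key c
    rw [two_smul, ← two_mul] at h1
    exact h1.symm

lemma exists_tour_of_isRooted {c : Finset V → ℝ} {c' : Sym2 V → ℝ}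
    (hcc : ∀ u v, u ≠ v → c {u, v} = c' s(u, v)) (hc0 : ∀ e, 0 ≤ c' e)
    (hcd : ∀ a, c' s(a, a) = 0) (hc : ∀ u v w, c' s(u, w) ≤ c' s(u, v) + c' s(v, w))
    {r : V} {U : Finset V} {par : V → V} {rk : V → ℕ}
    (h : IsRooted r U par rk) {x : Sym2 V → ℝ} (hx : ∀ e, 0 ≤ x e) {y η : V → ℝ} {β δ : ℝ}
    (hβ : 0 ≤ β) (hβ1 : 2 * β ≤ 1) (hβδ : β * (3 - δ) = 1)
    (hcut : ∀ S : Finset V, r ∉ S → ∀ v ∈ S, v ∈ U → 2 * y v ≤ cutVal x S)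
    (hyδ : ∀ v ∈ U, v ≠ r → δ ≤ y v) (hη1 : ∀ v, η v ≤ 1)
    (hpath : ∀ v ∈ U, v ≠ r → ∃ w ∈ U, Relation.ReflTransGen (Step r U par) w v ∧ y w = η v) :
    ∃ t : List V, t.Nodup ∧ t.head? = some r ∧ (∀ v ∈ U, v ∈ t) ∧
      tourCost c t ≤ β * ∑ e, x e * c' e
        + ∑ v ∈ U.erase r, (2 - 2 * β * η v) * c' s(v, par v) := by
  set z : Sym2 V → ℝ := fun e => β * x e
      + ∑ v ∈ U.erase r, if e = s(v, par v) then 1 - 2 * β * η v else 0 with hz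
  have hz0 : ∀ e, 0 ≤ z e := by
    intro e
    refine add_nonneg (mul_nonneg hβ (hx e)) (Finset.sum_nonneg fun v _ => ?_)
    split_ifs
    · nlinarith [hη1 v]
    · rfl
  obtain ⟨m, hm, hmc⟩ := exists_isPM_le (odds r U par) even_card_odds c' hc0 hc z hz0
    fun S hS => one_le_cutVal_join h hβ hβ1 hβδ hcut hyδ hη1 hpath hS
  obtain ⟨N, hN, hNc⟩ := exists_matching_edges hm c'
  obtain ⟨t, ht, hhead, htc, htm⟩ := exists_tour hcc hc0 hcd hc (edges r U par + N) r fun v => by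
    rw [mdeg_add, hN]
    simp only [odds, Finset.mem_filter, Finset.mem_univ, true_and]
    split_ifs with ho
    · exact ho.add_one
    · simpa using ho
  refine ⟨t, ht, hhead, fun v hv => htm v ?_, htc.trans ?_⟩
  · obtain ⟨k, hk⟩ : ∃ k, rk v = k := ⟨_, rfl⟩
    induction k using Nat.strong_induction_on generalizing v with
    | _ k ih =>
    by_cases hvr : v = r
    · rw [hvr]; exact Relation.ReflTransGen.refl
    · refine (ih _ (hk ▸ h.rk_lt v hv hvr) _ (h.par_mem v hv hvr) rfl).trans (Reach.symm ?_)
      refine Reach.of_mem (Multiset.mem_toFinset.2 (Multiset.mem_add.2 (Or.inl ?_)))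
      exact Multiset.mem_map.2 ⟨v, Finset.mem_erase.2 ⟨hvr, hv⟩, rfl⟩
  · have h1 : ∑ e, z e * c' e = β * ∑ e, x e * c' e
        + ∑ v ∈ U.erase r, (1 - 2 * β * η v) * c' s(v, par v) := cutVal_join _ _ _ _
    have h2 : ((edges r U par).map c').sum = ∑ v ∈ U.erase r, c' s(v, par v) := by
      simp only [edges, Multiset.map_map, Function.comp_def]; rfl
    have h3 : ∑ v ∈ U.erase r, (2 - 2 * β * η v) * c' s(v, par v)
        = ∑ v ∈ U.erase r, c' s(v, par v)
          + ∑ v ∈ U.erase r, (1 - 2 * β * η v) * c' s(v, par v) := by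
      rw [← Finset.sum_add_distrib]
      exact Finset.sum_congr rfl fun v _ => by ring
    rw [Multiset.map_add, Multiset.sum_add, h2, h3]
    linarith

end RootedTrees

section Rounding

open MeasureTheory

lemma exists_threshold_le {ι : Type*} [Fintype ι] (a f : ι → ℝ) (hf0 : ∀ i, 0 ≤ f i)
    (hf1 : ∀ i, f i ≤ 1) :
    ∃ u : ℝ, 0 < u ∧ ∑ i, a i * (if u ≤ f i then 1 else 0) ≤ ∑ i, a i * f i := by
  let μ : Measure ℝ := volume.restrict (Set.Ioc 0 1)
  have : IsProbabilityMeasure μ := ⟨by simp [μ]⟩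
  have hind : ∀ i, (fun u : ℝ => if u ≤ f i then (1:ℝ) else 0)
      = (Set.Iic (f i)).indicator fun _ => 1 := by
    intro i; ext u; simp [Set.indicator_apply]
  have hintg : ∀ i, Integrable (fun u : ℝ => a i * if u ≤ f i then (1:ℝ) else 0) μ := by
    intro i
    rw [show (fun u : ℝ => a i * if u ≤ f i then (1:ℝ) else 0)
      = fun u => a i * (Set.Iic (f i)).indicator (fun _ => (1:ℝ)) u by
        ext u; rw [← hind i]]
    exact ((integrable_const (1:ℝ)).indicator measurableSet_Iic).const_mul _
  have hval : ∀ i, ∫ u, (if u ≤ f i then (1:ℝ) else 0) ∂μ = f i := by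
    intro i
    rw [hind i, integral_indicator_const _ measurableSet_Iic]
    have : Set.Iic (f i) ∩ Set.Ioc 0 1 = Set.Ioc 0 (f i) := by
      ext u
      simp only [Set.mem_inter_iff, Set.mem_Iic, Set.mem_Ioc]
      have := hf1 i
      constructor
      · rintro ⟨h1, h2, h3⟩; exact ⟨h2, h1⟩
      · rintro ⟨h1, h2⟩; exact ⟨h2, h1, h2.trans this⟩
    simp [μ, Measure.real, Measure.restrict_apply measurableSet_Iic, this, hf0 i]
  have hN : μ (Set.Ioc 0 1)ᶜ = 0 := by
    simp [μ, Measure.restrict_apply measurableSet_Ioc.compl]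
  obtain ⟨u, hu, hle⟩ := exists_notMem_null_le_integral
    (integrable_finsetSum Finset.univ fun i _ => hintg i) hN
  refine ⟨u, (not_not.1 hu).1, ?_⟩
  rw [integral_finsetSum _ fun i _ => hintg i] at hle
  simpa only [integral_const_mul, hval, Finset.sum_apply] using hle

/-- The threshold of a vertex covered to extent `t`. -/
noncomputable def thr (α t : ℝ) : ℝ := max 0 (min 1 (α - (α - 1) / t))

lemma thr_nonneg (α t : ℝ) : 0 ≤ thr α t := le_max_left _ _

lemma thr_le_one (α t : ℝ) : thr α t ≤ 1 := max_le zero_le_one (min_le_left _ _)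

lemma thr_mono {α s t : ℝ} (hα : 1 ≤ α) (hs : 0 < s) (h : s ≤ t) : thr α s ≤ thr α t := by
  unfold thr
  have : 0 ≤ α - 1 := by linarith
  gcongr

lemma thr_mul_le {α β t : ℝ} (hβ : 0 ≤ β) (hβ1 : 2 * β ≤ 1) (hα : 1 ≤ α * (1 - β)) (ht : 0 < t)
    (ht1 : t ≤ 1) : thr α t * (2 - 2 * β * t) ≤ 2 - 2 * β := by
  have hα0 : 0 ≤ α := by nlinarith
  have hK : 0 ≤ 2 - 2 * β * t := by nlinarith
  have h1 : thr α t ≤ max 0 (α - (α - 1) / t) := max_le_max le_rfl (min_le_right _ _)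
  refine (mul_le_mul_of_nonneg_right h1 hK).trans ?_
  rcases max_cases 0 (α - (α - 1) / t) with ⟨h, -⟩ | ⟨h, -⟩
  · rw [h]; linarith
  · rw [h]
    have h2 : (α - (α - 1) / t) * (2 - 2 * β * t)
        = 2 * ((α * t - (α - 1)) * (1 - β * t)) / t := by field_simp
    rw [h2, div_le_iff₀ ht]
    have h3 : 0 ≤ α * β := mul_nonneg hα0 hβ
    nlinarith [mul_nonneg h3 (sq_nonneg (1 - t)),
      mul_nonneg (sub_nonneg.2 ht1) (sub_nonneg.2 hα)]

lemma one_sub_thr_mul_le {α t : ℝ} (hα : 1 ≤ α) (ht : 0 < t) (ht1 : t ≤ 1) :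
    1 - thr α t * t ≤ α * (1 - t) := by
  have h1 : α - (α - 1) / t ≤ 1 := by
    have : α - 1 ≤ (α - 1) / t := by
      rw [le_div_iff₀ ht]; nlinarith
    linarith
  have h2 : α - (α - 1) / t ≤ thr α t := by
    unfold thr; rw [min_eq_right h1]; exact le_max_right _ _
  have h3 := mul_le_mul_of_nonneg_right h2 ht.le
  rw [sub_mul, div_mul_cancel₀ _ ht.ne'] at h3
  linarith

variable {V : Type*} [Fintype V] [DecidableEq V]

open IsRooted

lemma exists_maxDesc {r : V} {W : Finset V} {par : V → V} {y : V → ℝ} (hy1 : ∀ v, y v ≤ 1) :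
    ∃ η : V → ℝ, (∀ v, η v ≤ 1) ∧
      (∀ v ∈ W, ∃ w ∈ W, Relation.ReflTransGen (Step r W par) w v ∧ y w = η v) ∧
      ∀ v ∈ W, ∀ w ∈ W, Relation.ReflTransGen (Step r W par) w v → y w ≤ η v := by
  classical
  have h : ∀ v, ∃ e : ℝ, e ≤ 1 ∧
      (v ∈ W → ∃ w ∈ W, Relation.ReflTransGen (Step r W par) w v ∧ y w = e) ∧
      (v ∈ W → ∀ w ∈ W, Relation.ReflTransGen (Step r W par) w v → y w ≤ e) := by
    intro v
    by_cases hv : v ∈ W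
    · obtain ⟨w, hw, hmax⟩ := Finset.exists_max_image
        (W.filter fun w => Relation.ReflTransGen (Step r W par) w v) y
        ⟨v, Finset.mem_filter.2 ⟨hv, Relation.ReflTransGen.refl⟩⟩
      obtain ⟨hwW, hwv⟩ := Finset.mem_filter.1 hw
      exact ⟨y w, hy1 w, fun _ => ⟨w, hwW, hwv, rfl⟩,
        fun _ w' hw' hp => hmax w' (Finset.mem_filter.2 ⟨hw', hp⟩)⟩
    · exact ⟨1, le_rfl, fun h => absurd h hv, fun h => absurd h hv⟩
  choose η h1 h2 h3 using h
  exact ⟨η, h1, h2, h3⟩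

lemma path_of_forall_mem {r : V} {W U : Finset V} {par : V → V} {w v : V}
    (hp : Relation.ReflTransGen (Step r W par) w v)
    (hU : ∀ a ∈ W, Relation.ReflTransGen (Step r W par) w a → a ∈ U) :
    Relation.ReflTransGen (Step r U par) w v := by
  induction hp with
  | refl => exact Relation.ReflTransGen.refl
  | tail hp hs ih => exact ih.tail ⟨hU _ hs.1 hp, hs.2⟩

/-- Rounding a single tree. -/
lemma exists_tour_of_tree {c : Finset V → ℝ} {c' : Sym2 V → ℝ}
    (hcc : ∀ u v, u ≠ v → c {u, v} = c' s(u, v)) (hc0 : ∀ e, 0 ≤ c' e)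
    (hcd : ∀ a, c' s(a, a) = 0) (hc : ∀ u v w, c' s(u, w) ≤ c' s(u, v) + c' s(v, w))
    {π : V → ℝ} (hπ : ∀ v, 0 ≤ π v) {r : V} {W : Finset V} {par : V → V} {rk : V → ℕ}
    (h : IsRooted r W par rk) {x : Sym2 V → ℝ} (hx : ∀ e, 0 ≤ x e) {y : V → ℝ} {α β δ : ℝ}
    (hβ : 0 ≤ β) (hβ1 : 2 * β ≤ 1) (hβδ : β * (3 - δ) = 1) (hδ : 0 ≤ δ) (hα : 1 ≤ α * (1 - β))
    (hα1 : 1 ≤ α) (hcut : ∀ S : Finset V, r ∉ S → ∀ v ∈ S, v ∈ W → 2 * y v ≤ cutVal x S)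
    (hyδ : ∀ v ∈ W, δ < y v) (hy1 : ∀ v, y v ≤ 1) :
    ∃ t : List V, t.Nodup ∧ t.head? = some r ∧
      tourCost c t + ∑ v ∈ Finset.univ \ t.toFinset, π v ≤
        β * ∑ e, x e * c' e + (2 - 2 * β) * ∑ v ∈ W.erase r, c' s(v, par v)
          + ∑ v, π v - ∑ v ∈ W, π v * thr α (y v) := by
  obtain ⟨η, hη1, hηex, hηmax⟩ := exists_maxDesc (r := r) (W := W) (par := par) hy1
  have hyη : ∀ v ∈ W, y v ≤ η v := fun v hv => hηmax v hv v hv Relation.ReflTransGen.refl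
  have hy0 : ∀ v ∈ W, 0 < y v := fun v hv => hδ.trans_lt (hyδ v hv)
  have hη0 : ∀ v ∈ W, 0 < η v := fun v hv => (hy0 v hv).trans_le (hyη v hv)
  obtain ⟨u, hu0, hu⟩ := exists_threshold_le
    (Sum.elim (fun v => if v ∈ W.erase r then (2 - 2 * β * η v) * c' s(v, par v) else 0)
      (fun v => if v ∈ W then - π v else 0))
    (Sum.elim (fun v => thr α (η v)) (fun v => thr α (y v)))
    (by rintro (v | v) <;> exact thr_nonneg _ _) (by rintro (v | v) <;> exact thr_le_one _ _)
  rw [Fintype.sum_sum_type, Fintype.sum_sum_type] at hu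
  replace hu : ∑ v, (if v ∈ W.erase r then (2 - 2 * β * η v) * c' s(v, par v) else 0)
        * (if u ≤ thr α (η v) then 1 else 0)
      + ∑ v, (if v ∈ W then - π v else 0) * (if u ≤ thr α (y v) then 1 else 0)
      ≤ ∑ v, (if v ∈ W.erase r then (2 - 2 * β * η v) * c' s(v, par v) else 0) * thr α (η v)
      + ∑ v, (if v ∈ W then - π v else 0) * thr α (y v) := hu
  simp only [ite_mul, zero_mul, Finset.sum_ite_mem, Finset.univ_inter] at hu
  let U : Finset V := W.filter fun v => v = r ∨ u ≤ thr α (η v)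
  have hUW : U ⊆ W := Finset.filter_subset _ _
  have hηle : ∀ a ∈ W, ∀ w ∈ W, Relation.ReflTransGen (Step r W par) w a →
      u ≤ thr α (y w) → a ∈ U := fun a ha w hw hp hle =>
    Finset.mem_filter.2 ⟨ha, Or.inr (hle.trans (thr_mono hα1 (hy0 w hw) (hηmax a ha w hw hp)))⟩
  have hpathU : ∀ v ∈ U, v ≠ r → ∃ w ∈ W, Relation.ReflTransGen (Step r W par) w v ∧
      y w = η v ∧ u ≤ thr α (y w) := by
    intro v hv hvr
    obtain ⟨hvW, hvu⟩ := Finset.mem_filter.1 hv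
    obtain ⟨w, hw, hp, hyw⟩ := hηex v hvW
    exact ⟨w, hw, hp, hyw, hyw ▸ hvu.resolve_left hvr⟩
  have hU : IsRooted r U par rk := by
    refine ⟨Finset.mem_filter.2 ⟨h.root_mem, Or.inl rfl⟩, fun v hv hvr => ?_,
      fun v hv => h.rk_lt v (hUW hv)⟩
    obtain ⟨w, hw, hp, -, hle⟩ := hpathU v hv hvr
    exact hηle _ (h.par_mem v (hUW hv) hvr) w hw (hp.tail ⟨hUW hv, hvr, rfl⟩) hle
  obtain ⟨t, ht, hhead, hUt, htc⟩ := exists_tour_of_isRooted hcc hc0 hcd hc hU hx (y := y) (η := η)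
    hβ hβ1 hβδ (fun S hS v hv hvU => hcut S hS v hv (hUW hvU))
    (fun v hv _ => (hyδ v (hUW hv)).le) hη1 (fun v hv hvr => by
      obtain ⟨w, hw, hp, hyw, hle⟩ := hpathU v hv hvr
      exact ⟨w, hηle w hw w hw Relation.ReflTransGen.refl hle,
        path_of_forall_mem hp fun a ha hpa => hηle a ha w hw hpa hle, hyw⟩)
  refine ⟨t, ht, hhead, ?_⟩
  have h1 : ∑ v ∈ U.erase r, (2 - 2 * β * η v) * c' s(v, par v)
      = ∑ v ∈ W.erase r, (2 - 2 * β * η v) * c' s(v, par v)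
        * (if u ≤ thr α (η v) then 1 else 0) := by
    simp only [mul_ite, mul_one, mul_zero]
    rw [← Finset.sum_filter]
    refine Finset.sum_congr ?_ fun _ _ => rfl
    ext v
    simp only [U, Finset.mem_erase, Finset.mem_filter]
    tauto
  have h2 : ∑ v ∈ Finset.univ \ t.toFinset, π v
      ≤ ∑ v, π v + ∑ v ∈ W, - π v * (if u ≤ thr α (y v) then 1 else 0) := by
    rw [← Finset.sum_sdiff (Finset.subset_univ t.toFinset), add_assoc]
    refine le_add_of_nonneg_right ?_
    have h3 : ∑ v ∈ W, π v * (if u ≤ thr α (y v) then 1 else 0) ≤ ∑ v ∈ t.toFinset, π v := by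
      simp only [mul_ite, mul_one, mul_zero]
      rw [← Finset.sum_filter]
      refine Finset.sum_le_sum_of_subset_of_nonneg (fun v hv => ?_) fun v _ _ => hπ v
      obtain ⟨hvW, hvu⟩ := Finset.mem_filter.1 hv
      exact List.mem_toFinset.2 (hUt v (hηle v hvW v hvW Relation.ReflTransGen.refl hvu))
    simp only [neg_mul, Finset.sum_neg_distrib]
    linarith
  have h3 : ∑ v ∈ W.erase r, (2 - 2 * β * η v) * c' s(v, par v) * thr α (η v)
      ≤ (2 - 2 * β) * ∑ v ∈ W.erase r, c' s(v, par v) := by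
    rw [Finset.mul_sum]
    refine Finset.sum_le_sum fun v hv => ?_
    have := mul_le_mul_of_nonneg_right
      (thr_mul_le hβ hβ1 hα (hη0 v (Finset.mem_of_mem_erase hv)) (hη1 v)) (hc0 s(v, par v))
    linarith
  simp only [neg_mul, Finset.sum_neg_distrib] at hu h2
  rw [h1] at htc
  linarith

/-- Rounding a solution of the relaxation, with weights on unordered pairs. -/
theorem exists_tour_of_lp {c : Finset V → ℝ} {c' : Sym2 V → ℝ}
    (hcc : ∀ u v, u ≠ v → c {u, v} = c' s(u, v)) (hc0 : ∀ e, 0 ≤ c' e)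
    (hcd : ∀ a, c' s(a, a) = 0) (hc : ∀ u v w, c' s(u, w) ≤ c' s(u, v) + c' s(v, w))
    {π : V → ℝ} (hπ : ∀ v, 0 ≤ π v) {r : V} {x : Sym2 V → ℝ} (hx : ∀ e, 0 ≤ x e) {y : V → ℝ}
    (hyr : y r = 1) (hy1 : ∀ v, y v ≤ 1)
    (hcut : ∀ S : Finset V, r ∉ S → ∀ v ∈ S, 2 * y v ≤ cutVal x S) {α β δ : ℝ}
    (hβ : 0 ≤ β) (hβ1 : 2 * β ≤ 1) (hβδ : β * (3 - δ) = 1) (hδ : 0 ≤ δ) (hδ1 : δ < 1)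
    (hα : 1 ≤ α * (1 - β)) (hα1 : 1 ≤ α) (hαδ : 1 ≤ α * (1 - δ)) (hαβ : 2 - β ≤ α) :
    ∃ t : List V, t.Nodup ∧ t.head? = some r ∧
      tourCost c t + ∑ v ∈ Finset.univ \ t.toFinset, π v ≤
        α * (∑ e, x e * c' e + ∑ v, π v * (1 - y v)) := by
  classical
  let y' : V → ℝ := fun v => if δ < y v then y v else 0
  have hy'0 : ∀ v, 0 ≤ y' v := fun v => by
    simp only [y']; split_ifs <;> linarith
  have hy'1 : ∀ v, y' v ≤ 1 := fun v => by
    simp only [y']; split_ifs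
    · exact hy1 v
    · exact zero_le_one
  have hx' : Covers (req r y') x := covers_req_iff.2 ⟨hx, fun S hS v hv => by
    simp only [y']; split_ifs
    · exact hcut S hS v hv
    · simpa using cutVal_nonneg hx S⟩
  obtain ⟨z, hz, hzc, hzd⟩ := exists_splitOff_cheap (isProper_req r y') c' hc x hx'
  obtain ⟨hz0, hzcut⟩ := covers_req_iff.1 hz
  have hdeg : ∀ v, v ≠ r → cutVal z {v} = 2 * y' v := by
    intro v hv
    have hv' : r ∉ ({v} : Finset V) := by simpa using hv.symm
    refine le_antisymm ((hzd v).trans (max_le (by linarith [hy'0 v]) ?_))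
      (hzcut _ hv' v (Finset.mem_singleton_self v))
    rw [req_le_iff hv' (by linarith [hy'0 v])]
    intro w hw
    rw [Finset.mem_singleton.1 hw]
  obtain ⟨p, hp, hpe, hpv⟩ := exists_treeDist r z y' hz0 hy'0 hy'1 hdeg hzcut
  have hexp : expec p (fun T => (2 - 2 * β) * (∑ e, inT e T * c' e)
      - ∑ v, π v * thr α (y v) * cov r v T)
      ≤ (2 - 2 * β) * ∑ e, z e * c' e - ∑ v, π v * thr α (y v) * y' v := by
    rw [expec_sub, expec_mul_left, expec_sum, expec_sum]
    refine sub_le_sub (mul_le_mul_of_nonneg_left (Finset.sum_le_sum fun e _ => ?_) (by linarith))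
      (Finset.sum_le_sum fun v _ => ?_)
    · simp only [mul_comm _ (c' e), expec_mul_left]
      by_cases hed : e.IsDiag
      · induction e using Sym2.ind with | _ a b =>
        rw [Sym2.mk_isDiag_iff] at hed
        rw [hed, hcd]; simp
      · exact mul_le_mul_of_nonneg_left (hpe e hed) (hc0 e)
    · rw [expec_mul_left]
      exact mul_le_mul_of_nonneg_left (hpv v) (mul_nonneg (hπ v) (thr_nonneg _ _))
  obtain ⟨T, hpT, hT⟩ := exists_le_expec hp hexp
  obtain ⟨W, par, rk, hW, hroot, hWT⟩ := exists_isRooted T r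
  have hedge : ∀ e ∈ T, ¬ e.IsDiag → 0 < z e := by
    intro e he hed
    refine lt_of_lt_of_le ?_ (hpe e hed)
    have h1 : p T * inT e T ≤ expec p (inT e) :=
      Finset.single_le_sum (f := fun A => p A * inT e A)
        (fun A _ => mul_nonneg (hp.nonneg A) (inT_nonneg e A)) (Finset.mem_univ T)
    rw [inT, if_pos he, mul_one] at h1
    exact hpT.trans_le h1
  have hyδ : ∀ v ∈ W, δ < y v := by
    intro v hv
    by_cases hvr : v = r
    · rw [hvr, hyr]; exact hδ1
    have hne := hroot.par_ne hv hvr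
    have h1 := hedge _ (hWT v hv hvr) (by rwa [Sym2.mk_isDiag_iff])
    have h2 : z s(par v, v) ≤ cutVal z {v} := by
      rw [cutVal_singleton]
      exact Finset.single_le_sum (f := fun a => z s(a, v)) (fun a _ => hz0 _)
        (Finset.mem_erase.2 ⟨hne.symm, Finset.mem_univ _⟩)
    rw [hdeg v hvr, Sym2.eq_swap] at h2
    by_contra hcon
    simp only [y', if_neg hcon] at h2
    linarith
  obtain ⟨t, ht, hhead, htc⟩ := exists_tour_of_tree hcc hc0 hcd hc hπ hroot hz0 (y := y) hβ hβ1
    hβδ hδ hα hα1 (fun S hS v hv hvW => by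
      have := hzcut S hS v hv
      simpa only [y', if_pos (hyδ v hvW)] using this) hyδ hy1
  refine ⟨t, ht, hhead, htc.trans ?_⟩
  have h1 := mul_le_mul_of_nonneg_left (hroot.sum_le hWT hc0) (show 0 ≤ 2 - 2 * β by linarith)
  have h2 : ∑ v, π v * thr α (y v) * cov r v T = ∑ v ∈ W, π v * thr α (y v) := by
    simp only [cov, mul_ite, mul_one, mul_zero, ← hW]
    rw [Finset.sum_ite_mem, Finset.univ_inter]
  have h3 : ∑ v, π v - ∑ v, π v * thr α (y v) * y' v ≤ α * ∑ v, π v * (1 - y v) := by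
    rw [← Finset.sum_sub_distrib, Finset.mul_sum]
    refine Finset.sum_le_sum fun v _ => ?_
    suffices 1 - thr α (y v) * y' v ≤ α * (1 - y v) by
      have := mul_le_mul_of_nonneg_left this (hπ v)
      linarith
    simp only [y']
    split_ifs with hv
    · exact one_sub_thr_mul_le hα1 (hδ.trans_lt hv) (hy1 v)
    · nlinarith
  have h4 : (2 - β) * ∑ e, z e * c' e ≤ α * ∑ e, x e * c' e := by
    have h5 : 0 ≤ ∑ e, z e * c' e := Finset.sum_nonneg fun e _ => mul_nonneg (hz0 e) (hc0 e)
    calc (2 - β) * ∑ e, z e * c' e ≤ α * ∑ e, z e * c' e := mul_le_mul_of_nonneg_right hαβ h5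
      _ ≤ _ := mul_le_mul_of_nonneg_left hzc (by linarith)
  rw [h2] at hT
  linarith

end Rounding

section Edges

variable {V : Type*} [Fintype V] [DecidableEq V]

/-- Edge weights as a function on unordered pairs, zero on the diagonal. -/
def offDiag (g : Finset V → ℝ) (e : Sym2 V) : ℝ := if e.IsDiag then 0 else g e.toFinset

lemma offDiag_mk (g : Finset V → ℝ) (a b : V) :
    offDiag g s(a, b) = if a = b then 0 else g {a, b} := by
  simp [offDiag, Sym2.toFinset_mk_eq]

lemma sum_completeEdges (g : Finset V → ℝ) :
    ∑ e ∈ completeEdges V, g e = ∑ e, offDiag g e := by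
  simp only [offDiag]
  have h : ∑ e : Sym2 V, (if e.IsDiag then 0 else g e.toFinset)
      = ∑ e : Sym2 V with ¬ e.IsDiag, g e.toFinset := by
    rw [Finset.sum_filter]
    exact Finset.sum_congr rfl fun e _ => (ite_not _ _ _).symm
  rw [h]
  symm
  refine Finset.sum_nbij Sym2.toFinset (fun e he => ?_) (fun e he e' he' h => ?_)
    (fun e he => ?_) fun _ _ => rfl
  · rw [Finset.mem_filter] at he
    simp [completeEdges, Finset.mem_powersetCard, Sym2.card_toFinset_of_not_isDiag _ he.2]
  · refine Sym2.ext fun a => ?_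
    rw [← Sym2.mem_toFinset, h, Sym2.mem_toFinset]
  · obtain ⟨a, b, hab, rfl⟩ := Finset.card_eq_two.1
      (Finset.mem_powersetCard.1 (Finset.mem_coe.1 he)).2
    exact ⟨s(a, b), by simpa using hab, Sym2.toFinset_mk_eq⟩

lemma sum_cutEdges (x : Finset V → ℝ) (S : Finset V) :
    ∑ e ∈ cutEdges V S, x e = cutVal (offDiag x) S := by
  rw [cutEdges, Finset.sum_filter, sum_completeEdges]
  refine Finset.sum_congr rfl fun e _ => ?_
  induction e using Sym2.ind with | _ a b =>
  rw [offDiag_mk, offDiag_mk, cutInd_mk]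
  by_cases hab : a = b
  · simp [hab]
  · by_cases ha : a ∈ S <;> by_cases hb : b ∈ S <;>
      simp [hab, ha, hb, Finset.insert_inter_of_mem, Finset.insert_inter_of_notMem]

end Edges

end PCTSP

/-- for every `δ ∈ [0,1)` there is a tour of value at most
`max{(5-2δ)/(3-δ), (3-δ)/(2-δ), 1/(1-δ)}` times the LP value. -/
theorem pctsp_gap_le_alpha (δ : ℝ) (hδ0 : 0 ≤ δ) (hδ1 : δ < 1)
    (V : Type*) [Fintype V] [DecidableEq V]
    (hV : 2 ≤ Fintype.card V) (r : V)
    (c : Finset V → ℝ) (π : V → ℝ)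
    (hc : ∀ e ∈ completeEdges V, 0 ≤ c e)
    (htri : ∀ u v w : V, u ≠ v → v ≠ w → u ≠ w → c {u, w} ≤ c {u, v} + c {v, w})
    (hπ : ∀ v : V, 0 ≤ π v) (hπr : π r = 0)
    (x : Finset V → ℝ) (y : V → ℝ) (hxy : IsFeasibleLP r x y) :
    ∃ t : List V, t.Nodup ∧ t.head? = some r ∧
      tourCost c t + ∑ v ∈ Finset.univ \ t.toFinset, π v ≤
        max (max ((5 - 2 * δ) / (3 - δ)) ((3 - δ) / (2 - δ))) (1 / (1 - δ)) *
          (∑ e ∈ completeEdges V, c e * x e + ∑ v : V, π v * (1 - y v)) := by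
  obtain ⟨hx0, hy0, hyr, -, hdr, hcut⟩ := hxy
  have hmem : ∀ a b : V, a ≠ b → {a, b} ∈ completeEdges V := fun a b hab => by
    simp [completeEdges, Finset.mem_powersetCard, Finset.card_pair hab]
  have hnn : ∀ g : Finset V → ℝ, (∀ e ∈ completeEdges V, 0 ≤ g e) → ∀ e, 0 ≤ PCTSP.offDiag g e := by
    intro g hg e
    induction e using Sym2.ind with | _ a b =>
    rw [PCTSP.offDiag_mk]
    split_ifs with hab
    · exact le_rfl
    · exact hg _ (hmem a b hab)
  simp only [PCTSP.sum_cutEdges] at hdr hcut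
  set α := max (max ((5 - 2 * δ) / (3 - δ)) ((3 - δ) / (2 - δ))) (1 / (1 - δ))
  have h3 : 0 < 3 - δ := by linarith
  have h2 : 0 < 2 - δ := by linarith
  have h1 : 0 < 1 - δ := by linarith
  have hα1 : (5 - 2 * δ) / (3 - δ) ≤ α := (le_max_left _ _).trans (le_max_left _ _)
  have hα2 : (3 - δ) / (2 - δ) ≤ α := (le_max_right _ _).trans (le_max_left _ _)
  have hα3 : 1 / (1 - δ) ≤ α := le_max_right _ _
  have hβδ : 1 / (3 - δ) * (3 - δ) = 1 := by field_simp
  have hβ : 0 ≤ 1 / (3 - δ) := by positivity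
  rw [div_le_iff₀ h2] at hα2
  rw [div_le_iff₀ h1] at hα3
  have hone : 1 ≤ α := by nlinarith
  obtain ⟨t, ht, hhead, htc⟩ := PCTSP.exists_tour_of_lp (c := c) (c' := PCTSP.offDiag c)
    (fun u v huv => by rw [PCTSP.offDiag_mk, if_neg huv]) (hnn c hc)
    (fun a => by rw [PCTSP.offDiag_mk, if_pos rfl])
    (fun u v w => by
      by_cases h1 : u = w
      · subst h1
        rw [PCTSP.offDiag_mk, if_pos rfl]
        exact add_nonneg (hnn c hc _) (hnn c hc _)
      by_cases h2 : u = v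
      · subst h2
        rw [PCTSP.offDiag_mk c u u, if_pos rfl, zero_add]
      by_cases h3 : v = w
      · subst h3
        rw [PCTSP.offDiag_mk c v v, if_pos rfl, add_zero]
      simpa only [PCTSP.offDiag_mk, if_neg h1, if_neg h2, if_neg h3] using htri u v w h2 h3 h1)
    hπ (r := r) (hnn x hx0) hyr
    (fun v => by
      by_cases hv : v = r
      · rw [hv, hyr]
      · have h4 := hcut {r}ᶜ (by simp) v (by simpa using hv)
        rw [PCTSP.cutVal_compl] at h4
        linarith)
    hcut (α := α) (β := 1 / (3 - δ)) (δ := δ) hβ (by nlinarith) hβδ hδ0 hδ1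
    (by
      rw [show 1 - 1 / (3 - δ) = (2 - δ) / (3 - δ) by field_simp; ring, mul_div_assoc',
        le_div_iff₀ h3]
      linarith)
    hone hα3
    (by
      refine le_trans (le_of_eq ?_) hα1
      field_simp; ring)
  refine ⟨t, ht, hhead, ?_⟩
  have hsum : ∑ e ∈ completeEdges V, c e * x e = ∑ e, PCTSP.offDiag x e * PCTSP.offDiag c e := by
    rw [PCTSP.sum_completeEdges]
    refine Finset.sum_congr rfl fun e _ => ?_
    unfold PCTSP.offDiag
    split_ifs
    · simp
    · ring
  rw [hsum]
  exact htc
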